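/- arXiv:1609.02380 — 3 statements merged into one kernel-verified Lean document; each statement's English description precedes it below -/
import Mathlib

section
/- Let the finite group A act by automorphisms on the finite group G. If 𝒪 is an orbit of A on the set of 𝒫-components of G, then the subgroup ⟨𝒪⟩ generated by the members of 𝒪 is an (A,𝒫)-component of G; conversely, every (A,𝒫)-component of G is generated by an orbit of A on the set of 𝒫-components of G; and distinct orbits generate distinct (A,𝒫)-components. -/
open Pointwise

namespace PaperPF
set_option linter.unusedVariables false

/-- A subgroup `K` is subnormal if there is a finite chain
`K = K₀ ⊴ K₁ ⊴ ⋯ ⊴ Kₙ = G` with each term normal in the next. -/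
def IsSubnormal {G : Type} [Group G] (K : Subgroup G) : Prop :=
  ∃ (n : ℕ) (c : Fin (n + 1) → Subgroup G),
    c 0 = K ∧ c (Fin.last n) = ⊤ ∧
      ∀ i : Fin n, c i.castSucc ≤ c i.succ ∧ ((c i.castSucc).subgroupOf (c i.succ)).Normal

/-- A finite group is quasisimple if it is perfect and its central quotient is a
nonabelian simple group. -/
def IsQuasisimple (X : Type) [Group X] : Prop :=
  commutator X = ⊤ ∧ IsSimpleGroup (X ⧸ Subgroup.center X) ∧
    ∃ a b : X ⧸ Subgroup.center X, a * b ≠ b * a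

/-- A component: a quasisimple subnormal subgroup. -/
def IsComponent {G : Type} [Group G] (K : Subgroup G) : Prop :=
  IsSubnormal K ∧ IsQuasisimple ↥K

/-- The subgroup generated by a family of subgroups. -/
def genBy {G : Type} [Group G] (S : Set (Subgroup G)) : Subgroup G :=
  Subgroup.closure (⋃ N ∈ S, (N : Set G))

theorem genBy_normal {G : Type} [Group G] {S : Set (Subgroup G)}
    (h : ∀ N ∈ S, N.Normal) : (genBy S).Normal := by
  constructor
  intro x hx g
  have hmap : Subgroup.map (MulAut.conj g).toMonoidHom (genBy S) ≤ genBy S := by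
    rw [genBy, MonoidHom.map_closure]
    apply Subgroup.closure_mono
    rintro y ⟨z, hz, rfl⟩
    simp only [Set.mem_iUnion] at hz ⊢
    obtain ⟨N, hN, hzN⟩ := hz
    exact ⟨N, hN, (h N hN).conj_mem z hzN g⟩
  exact hmap ⟨x, hx, rfl⟩

/-- `O_𝒫(G)`: the subgroup generated by all normal `𝒫`-subgroups. -/
def Op (P : (X : Type) → [inst : Group X] → Prop) (G : Type) [Group G] : Subgroup G :=
  genBy {N : Subgroup G | N.Normal ∧ P ↥N}

instance Op_normal (P : (X : Type) → [inst : Group X] → Prop) (G : Type) [Group G] :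
    (Op P G).Normal :=
  genBy_normal fun _ hN => hN.1

/-- `N` is normal with `𝒫` quotient. -/
def QuotIsP (P : (X : Type) → [inst : Group X] → Prop) {G : Type} [Group G]
    (N : Subgroup G) : Prop :=
  ∃ h : N.Normal, haveI := h; P (G ⧸ N)

/-- `O^𝒫(G)`: the intersection of all normal subgroups with `𝒫` quotient. -/
def Oup (P : (X : Type) → [inst : Group X] → Prop) (G : Type) [Group G] : Subgroup G :=
  ⨅ (N : Subgroup G) (_ : QuotIsP P N), N

/-- A `𝒫`-component. -/
def IsPComponent (P : (X : Type) → [inst : Group X] → Prop) {G : Type} [Group G]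
    (K : Subgroup G) : Prop :=
  IsSubnormal K ∧ IsQuasisimple (↥K ⧸ Op P ↥K) ∧ Oup P ↥K = ⊤

/-- The solvable radical. -/
def solRad (G : Type) [Group G] : Subgroup G :=
  genBy {N : Subgroup G | N.Normal ∧ IsSolvable ↥N}

/-- `O_{𝒫,E}(G) = O_𝒫(G) · L_𝒫(G)`. -/
def OPE (P : (X : Type) → [inst : Group X] → Prop) (G : Type) [Group G] : Subgroup G :=
  Op P G ⊔ sSup {K : Subgroup G | IsPComponent P K}



/-- The subgroup of points fixed by a single element `a`. -/
def fixedBySub {A : Type} (G : Type) [Monoid A] [Group G] [MulDistribMulAction A G]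
    (a : A) : Subgroup G where
  carrier := {x : G | a • x = x}
  one_mem' := smul_one a
  mul_mem' := fun {x y} hx hy => by
    show a • (x * y) = x * y
    rw [smul_mul', hx, hy]
  inv_mem' := fun {x} hx => by
    show a • x⁻¹ = x⁻¹
    rw [smul_inv', hx]

/-- The subgroup of points fixed by every element of a subgroup `B` of `A`. -/
def fixedOfSub {A : Type} (G : Type) [Group A] [Group G] [MulDistribMulAction A G]
    (B : Subgroup A) : Subgroup G where
  carrier := {x : G | ∀ b ∈ B, b • x = x}
  one_mem' := fun b _ => smul_one b
  mul_mem' := fun {x y} hx hy b hb => by rw [smul_mul', hx b hb, hy b hb]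
  inv_mem' := fun {x} hx b hb => by rw [smul_inv', hx b hb]

/-- The action of `A` restricted to an `A`-invariant subgroup. -/
def invSubAction (A : Type) {G : Type} [Monoid A] [Group G] [MulDistribMulAction A G]
    (K : Subgroup G) (hK : ∀ (a : A) (x : G), x ∈ K → a • x ∈ K) :
    MulDistribMulAction A ↥K where
  smul a x := ⟨a • (x : G), hK a x x.2⟩
  one_smul x := Subtype.ext (one_smul A (x : G))
  mul_smul a b x := Subtype.ext (mul_smul a b (x : G))
  smul_mul a x y := Subtype.ext (smul_mul' a (x : G) (y : G))
  smul_one a := Subtype.ext (smul_one a)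

/-- The map induced by `a • ·` on the quotient by an `A`-invariant normal subgroup. -/
def invQuotSMul (A : Type) {G : Type} [Monoid A] [Group G] [MulDistribMulAction A G]
    (N : Subgroup G) [N.Normal] (hN : ∀ (a : A) (x : G), x ∈ N → a • x ∈ N) (a : A) :
    G ⧸ N → G ⧸ N :=
  Quotient.map' (a • ·) (fun x y h => by
    rw [QuotientGroup.leftRel_apply] at h ⊢
    have := hN a _ h
    rwa [smul_mul', smul_inv'] at this)

theorem invQuotSMul_mk (A : Type) {G : Type} [Monoid A] [Group G] [MulDistribMulAction A G]
    (N : Subgroup G) [N.Normal] (hN : ∀ (a : A) (x : G), x ∈ N → a • x ∈ N) (a : A) (x : G) :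
    invQuotSMul A N hN a (x : G ⧸ N) = ((a • x : G) : G ⧸ N) := rfl

/-- The action of `A` induced on the quotient by an `A`-invariant normal subgroup. -/
def invQuotAction (A : Type) {G : Type} [Monoid A] [Group G] [MulDistribMulAction A G]
    (N : Subgroup G) [N.Normal] (hN : ∀ (a : A) (x : G), x ∈ N → a • x ∈ N) :
    MulDistribMulAction A (G ⧸ N) where
  smul := invQuotSMul A N hN
  one_smul q := QuotientGroup.induction_on q fun x => by
    show invQuotSMul A N hN 1 (x : G ⧸ N) = (x : G ⧸ N)
    rw [invQuotSMul_mk, one_smul]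
  mul_smul a b q := QuotientGroup.induction_on q fun x => by
    show invQuotSMul A N hN (a * b) (x : G ⧸ N)
        = invQuotSMul A N hN a (invQuotSMul A N hN b (x : G ⧸ N))
    rw [invQuotSMul_mk, invQuotSMul_mk, invQuotSMul_mk, mul_smul]
  smul_mul a q r := Quotient.inductionOn₂' q r fun x y => by
    show invQuotSMul A N hN a ((x : G ⧸ N) * (y : G ⧸ N))
        = invQuotSMul A N hN a (x : G ⧸ N) * invQuotSMul A N hN a (y : G ⧸ N)
    rw [← QuotientGroup.mk_mul, invQuotSMul_mk, invQuotSMul_mk, invQuotSMul_mk,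
      ← QuotientGroup.mk_mul, smul_mul']
  smul_one a := by
    show invQuotSMul A N hN a ((1 : G) : G ⧸ N) = ((1 : G) : G ⧸ N)
    rw [invQuotSMul_mk, smul_one]

/-- The action of `A` induced on the central quotient. -/
def centerQuotAction (A : Type) (X : Type) [Group A] [Group X] [MulDistribMulAction A X] :
    MulDistribMulAction A (X ⧸ Subgroup.center X) :=
  invQuotAction A (Subgroup.center X) (fun a x hx => by
    rw [Subgroup.mem_center_iff] at hx ⊢
    intro y
    calc y * a • x = a • (a⁻¹ • y * x) := by rw [smul_mul', smul_inv_smul]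
    _ = a • (x * a⁻¹ • y) := by rw [hx (a⁻¹ • y)]
    _ = a • x * y := by rw [smul_mul', smul_inv_smul])


/-- `X` is `A`-quasisimple: it is generated by its components, the set of components
is nonempty, and `A` permutes the components transitively. -/
def IsAQuasisimple (A X : Type) [Group A] [Group X] [MulDistribMulAction A X] : Prop :=
  {K : Subgroup X | IsComponent K}.Nonempty ∧
  sSup {K : Subgroup X | IsComponent K} = ⊤ ∧
  ∀ K L : Subgroup X, IsComponent K → IsComponent L → ∃ a : A, a • K = L

/-- An `A`-component: the subgroup generated by an orbit of `A` on the components. -/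
def IsAComponent (A : Type) {G : Type} [Group A] [Group G] [MulDistribMulAction A G]
    (K : Subgroup G) : Prop :=
  ∃ L : Subgroup G, IsComponent L ∧ K = ⨆ a : A, a • L

/-- An `(A,𝒫)`-component: an `A`-invariant subnormal subgroup `K` with
`K = O^𝒫(K)` and `K/O_𝒫(K)` `A`-quasisimple under the induced action. -/
def IsAPComponent (P : (X : Type) → [inst : Group X] → Prop) (A : Type) {G : Type}
    [Group A] [Group G] [MulDistribMulAction A G] (K : Subgroup G) : Prop :=
  IsSubnormal K ∧ Oup P ↥K = ⊤ ∧
  ∃ hK : ∀ (a : A) (x : G), x ∈ K → a • x ∈ K,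
    letI := invSubAction A K hK
    ∃ hOp : ∀ (a : A) (x : ↥K), x ∈ Op P ↥K → a • x ∈ Op P ↥K,
      letI := invQuotAction A (Op P ↥K) hOp
      IsAQuasisimple A (↥K ⧸ Op P ↥K)

/-- The commutator `[X, t]` of a subgroup with an element acting on `G`;
the subgroup generated by all `x⁻¹ * (t • x)`, `x ∈ X`. -/
def commSub {A : Type} {G : Type} [Monoid A] [Group G] [MulDistribMulAction A G]
    (t : A) (X : Subgroup G) : Subgroup G :=
  Subgroup.closure {y : G | ∃ x ∈ X, y = x⁻¹ * (t • x)}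


/-- `O_{n𝒫}(G)`: the subgroup generated by all `A`-invariant normal subgroups whose
fixed-point subgroup under `A` is a `𝒫`-group. -/
def OnP (P : (X : Type) → [inst : Group X] → Prop) (A : Type) (G : Type) [Monoid A] [Group G]
    [MulDistribMulAction A G] : Subgroup G :=
  genBy {N : Subgroup G | N.Normal ∧ (∀ (a : A) (x : G), x ∈ N → a • x ∈ N) ∧
    P ↥(N ⊓ FixedPoints.subgroup A G)}

/-- The group-theoretic property "is solvable". -/
def solP : (X : Type) → [inst : Group X] → Prop := fun X _ => IsSolvable X


open Subgroup

section Subnormality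

variable {G G' : Type} [Group G] [Group G']

/-- `H` is a normal subgroup of the subgroup `K`. -/
def NormIn (H K : Subgroup G) : Prop :=
  H ≤ K ∧ K ≤ normalizer (H : Set G)

/-- `H` is a subnormal subgroup of the subgroup `K`. -/
def Sn (H K : Subgroup G) : Prop :=
  Relation.ReflTransGen NormIn H K

theorem normIn_top_iff {H : Subgroup G} : NormIn H ⊤ ↔ H.Normal := by
  simp [NormIn, normalizer_eq_top_iff]

theorem NormIn.conj_mem {H K : Subgroup G} (h : NormIn H K) {x y : G} (hx : x ∈ K)
    (hy : y ∈ H) : x * y * x⁻¹ ∈ H :=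
  le_normalizer_iff.1 h.2 x hx y hy

theorem NormIn.map_conj_eq {H K : Subgroup G} (h : NormIn H K) {k : G} (hk : k ∈ K) :
    H.map (MulAut.conj k).toMonoidHom = H :=
  mem_normalizer_iff_map_conj_eq.1 (h.2 hk)

theorem NormIn.normal {H K : Subgroup G} (h : NormIn H K) : (H.subgroupOf K).Normal :=
  normal_subgroupOf_of_le_normalizer h.2

theorem NormIn.inf_right {H K : Subgroup G} (h : NormIn H K) (E : Subgroup G) :
    NormIn (H ⊓ E) (K ⊓ E) :=
  ⟨inf_le_inf_right E h.1, le_normalizer_iff.2 fun _ hx _ hy =>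
    ⟨h.conj_mem hx.1 hy.1, E.mul_mem (E.mul_mem hx.2 hy.2) (E.inv_mem hx.2)⟩⟩

theorem NormIn.map {H K : Subgroup G} (h : NormIn H K) (f : G →* G') :
    NormIn (H.map f) (K.map f) :=
  ⟨map_mono h.1, (map_mono h.2).trans (le_normalizer_map f)⟩

theorem NormIn.comap {H K : Subgroup G} (h : NormIn H K) (f : G' →* G) :
    NormIn (H.comap f) (K.comap f) :=
  ⟨comap_mono h.1, (comap_mono h.2).trans (le_normalizer_comap f)⟩

theorem Sn.refl (H : Subgroup G) : Sn H H := Relation.ReflTransGen.refl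

theorem NormIn.sn {H K : Subgroup G} (h : NormIn H K) : Sn H K :=
  Relation.ReflTransGen.single h

theorem Sn.trans {H K L : Subgroup G} (h : Sn H K) (h' : Sn K L) : Sn H L :=
  Relation.ReflTransGen.trans h h'

theorem Sn.le {H K : Subgroup G} (h : Sn H K) : H ≤ K := by
  induction h with
  | refl => exact le_rfl
  | tail _ h ih => exact ih.trans h.1

theorem Sn.inf_right {H K : Subgroup G} (h : Sn H K) (E : Subgroup G) :
    Sn (H ⊓ E) (K ⊓ E) :=
  Relation.ReflTransGen.lift (· ⊓ E) (fun _ _ h => NormIn.inf_right h E) _ _ h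

theorem Sn.map {H K : Subgroup G} (h : Sn H K) (f : G →* G') : Sn (H.map f) (K.map f) :=
  Relation.ReflTransGen.lift (Subgroup.map f) (fun _ _ h => NormIn.map h f) _ _ h

theorem Sn.comap {H K : Subgroup G} (h : Sn H K) (f : G' →* G) :
    Sn (H.comap f) (K.comap f) :=
  Relation.ReflTransGen.lift (Subgroup.comap f) (fun _ _ h => NormIn.comap h f) _ _ h

theorem Sn.of_le {H K E : Subgroup G} (h : Sn H K) (hHE : H ≤ E) (hEK : E ≤ K) : Sn H E := by
  simpa [inf_eq_left.2 hHE, inf_eq_right.2 hEK] using h.inf_right E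

theorem isSubnormal_iff_sn {H : Subgroup G} : IsSubnormal H ↔ Sn H ⊤ := by
  constructor
  · rintro ⟨n, c, rfl, htop, hc⟩
    rw [← htop]
    have : ∀ i : Fin (n + 1), Sn (c 0) (c i) := by
      intro i
      induction i using Fin.induction with
      | zero => exact Sn.refl _
      | succ i ih =>
        exact ih.trans (NormIn.sn
          ⟨(hc i).1, (normal_subgroupOf_iff_le_normalizer (hc i).1).1 (hc i).2⟩)
    exact this _
  · intro h
    induction h using Relation.ReflTransGen.head_induction_on with
    | refl => exact ⟨0, fun _ => ⊤, rfl, rfl, fun i => i.elim0⟩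
    | head h _ ih =>
      obtain ⟨n, c, h0, htop, hc⟩ := ih
      refine ⟨n + 1, Fin.cons _ c, rfl, by simpa [← Fin.succ_last] using htop, fun i => ?_⟩
      induction i using Fin.cases with
      | zero => subst h0; exact ⟨h.1, h.normal⟩
      | succ i => exact hc i

/-- The subgroup generated by the `K`-conjugates of `H`. -/
def conjSup (H K : Subgroup G) : Subgroup G :=
  ⨆ k : K, H.map (MulAut.conj (k : G)).toMonoidHom

theorem map_conj_le_conjSup {H K : Subgroup G} {k : G} (hk : k ∈ K) :
    H.map (MulAut.conj k).toMonoidHom ≤ conjSup H K :=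
  le_iSup (fun k : K => H.map (MulAut.conj (k : G)).toMonoidHom) ⟨k, hk⟩

theorem le_conjSup (H K : Subgroup G) : H ≤ conjSup H K := by
  refine le_trans (fun x hx => ?_) (map_conj_le_conjSup K.one_mem)
  exact ⟨x, hx, by simp⟩

theorem conjSup_le {H K N : Subgroup G} (hH : H ≤ N) (hK : K ≤ normalizer (N : Set G)) :
    conjSup H K ≤ N := by
  refine iSup_le fun k => ?_
  rintro _ ⟨x, hx, rfl⟩
  exact le_normalizer_iff.1 hK k k.2 x (hH hx)

theorem le_normalizer_iff_map {N K : Subgroup G} :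
    K ≤ normalizer (N : Set G) ↔ ∀ k ∈ K, N.map (MulAut.conj k).toMonoidHom ≤ N := by
  simp only [le_normalizer_iff, map_le_iff_le_comap]
  rfl

theorem le_normalizer_conjSup {H K E : Subgroup G} (hH : E ≤ normalizer (H : Set G))
    (hK : E ≤ normalizer (K : Set G)) : E ≤ normalizer (conjSup H K : Set G) := by
  rw [le_normalizer_iff_map]
  intro e he
  rw [conjSup, Subgroup.map_iSup]
  refine iSup_le fun k => le_trans ?_
    (map_conj_le_conjSup (le_normalizer_iff.1 hK e he k k.2))
  rintro _ ⟨_, ⟨x, hx, rfl⟩, rfl⟩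
  refine ⟨e * x * e⁻¹, le_normalizer_iff.1 hH e he x hx, ?_⟩
  simp [mul_assoc]

theorem le_normalizer_conjSup_self (H K : Subgroup G) :
    K ≤ normalizer (conjSup H K : Set G) := by
  rw [le_normalizer_iff_map]
  intro e he
  rw [conjSup, Subgroup.map_iSup]
  refine iSup_le fun k => le_trans ?_ (map_conj_le_conjSup (mul_mem he k.2))
  rintro _ ⟨_, ⟨x, hx, rfl⟩, rfl⟩
  exact ⟨x, hx, by simp [mul_assoc]⟩

theorem conjSup_sup (H K : Subgroup G) : conjSup H K ⊔ K = H ⊔ K := by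
  refine le_antisymm (sup_le ?_ le_sup_right) (sup_le_sup_right (le_conjSup H K) K)
  exact conjSup_le le_sup_left (le_sup_right.trans le_normalizer)

theorem NormIn.sup_sn {M K D : Subgroup G} (hM : NormIn M D) (hK : Sn K D) :
    Sn (M ⊔ K) D := by
  induction hK using Relation.ReflTransGen.head_induction_on with
  | refl => rw [sup_eq_right.2 hM.1]; exact Sn.refl _
  | @head K K₁ h h₁ ih =>
    refine Sn.trans (NormIn.sn ⟨sup_le_sup_left h.1 M, sup_le ?_ ?_⟩) ih
    · exact le_sup_left.trans le_normalizer
    · exact (le_inf ((Sn.le h₁).trans hM.2) h.2).trans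
        (normalizer_inf_normalizer_le_normalizer_sup M K)

theorem Sn.exists_lt {H D : Subgroup G} (h : Sn H D) (hne : H ≠ D) :
    ∃ M, M < D ∧ Sn H M ∧ NormIn M D := by
  induction h with
  | refl => exact absurd rfl hne
  | @tail M D h h' ih =>
    by_cases hMD : M = D
    · subst hMD
      exact ih hne
    · exact ⟨M, lt_of_le_of_ne h'.1 hMD, h, h'⟩

theorem sn_bot (D : Subgroup G) : Sn ⊥ D :=
  NormIn.sn ⟨bot_le, le_normalizer_of_normal⟩

theorem iSup_of_sup {ι : Type} [Finite ι] {p : Subgroup G → Prop} (hbot : p ⊥)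
    (hsup : ∀ H K, p H → p K → p (H ⊔ K)) {f : ι → Subgroup G} (hf : ∀ i, p (f i)) :
    p (⨆ i, f i) := by
  cases nonempty_fintype ι
  rw [← Finset.sup_univ_eq_iSup]
  exact Finset.sup_induction hbot (fun _ h _ h' => hsup _ _ h h') fun i _ => hf i

/-- Wielandt's join theorem for finite groups. -/
theorem Sn.sup [Finite G] {H K D : Subgroup G} (hH : Sn H D) (hK : Sn K D) : Sn (H ⊔ K) D := by
  induction D using WellFoundedLT.induction generalizing H K with
  | ind D ih =>
  by_cases hne : H = D
  · rw [hne, sup_eq_left.2 hK.le]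
    exact Sn.refl D
  obtain ⟨M, hMD, hHM, hM⟩ := hH.exists_lt hne
  have hH' : Sn (conjSup H K) M := by
    refine iSup_of_sup (p := (Sn · M)) (sn_bot M) (fun _ _ h h' => ih M hMD h h') fun k => ?_
    have := hHM.map (MulAut.conj (k : G)).toMonoidHom
    rwa [hM.map_conj_eq (hK.le k.2)] at this
  rw [← conjSup_sup]
  set H' := conjSup H K
  have hKH' : K ≤ normalizer (H' : Set G) := le_normalizer_conjSup_self H K
  set N := conjSup H' D
  have hNM : N ≤ M := conjSup_le hH'.le hM.2
  have hND : NormIn N D := ⟨hNM.trans hM.1, le_normalizer_conjSup_self H' D⟩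
  have hH'N : Sn H' N := hH'.of_le (le_conjSup H' D) hNM
  by_cases htop : N ⊔ K = D
  · by_cases hNH : H' = N
    · rw [hNH, htop]
      exact Sn.refl D
    obtain ⟨M₂, hM₂N, hH'M₂, hM₂⟩ := hH'N.exists_lt hNH
    have hT : D ≤ normalizer (conjSup H' N : Set G) := by
      rw [← htop]
      exact sup_le (le_normalizer_conjSup_self H' N)
        (le_normalizer_conjSup hKH' (hK.le.trans hND.2))
    have : N ≤ M₂ := (conjSup_le (le_conjSup H' N) hT).trans (conjSup_le hH'M₂.le hM₂.2)
    exact absurd this hM₂N.not_ge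
  · have hle : N ⊔ K ≤ D := sup_le hND.1 hK.le
    refine (ih (N ⊔ K) (lt_of_le_of_ne hle htop) ?_ ?_).trans (hND.sup_sn hK)
    · exact (hH'.trans hM.sn).of_le ((le_conjSup H' D).trans le_sup_left) hle
    · exact hK.of_le le_sup_right hle

end Subnormality

section Quasisimple

variable {X Y : Type} [Group X] [Group Y]

theorem IsQuasisimple.le_center {X : Type} [Group X] (h : IsQuasisimple X) {N : Subgroup X}
    [hN : N.Normal] (hne : N ≠ ⊤) : N ≤ center X := by
  have := h.2.1
  set q := QuotientGroup.mk' (center X)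
  have hq : Function.Surjective q := QuotientGroup.mk'_surjective _
  rcases (hN.map q hq).eq_bot_or_eq_top with hb | ht
  · rwa [Subgroup.map_eq_bot_iff, QuotientGroup.ker_mk'] at hb
  · refine absurd (top_le_iff.1 ?_) hne
    have hsup : N ⊔ center X = ⊤ := by
      rw [← QuotientGroup.ker_mk' (center X), ← Subgroup.comap_map_eq, ht, Subgroup.comap_top]
    rw [← h.1, commutator_def, Subgroup.commutator_le]
    intro x _ y _
    have hx : x ∈ N ⊔ center X := hsup ▸ mem_top x
    have hy : y ∈ N ⊔ center X := hsup ▸ mem_top y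
    obtain ⟨n, hn, z, hz, rfl⟩ := Subgroup.mem_sup_of_normal_right.1 hx
    obtain ⟨m, hm, w, hw, rfl⟩ := Subgroup.mem_sup_of_normal_right.1 hy
    have hz' := Subgroup.mem_center_iff.1 hz
    have hw' := Subgroup.mem_center_iff.1 hw
    rw [commutatorElement_def, mul_inv_rev, mul_inv_rev]
    have : n * z * (m * w) * (z⁻¹ * n⁻¹) * (w⁻¹ * m⁻¹) = n * m * n⁻¹ * m⁻¹ := by
      calc n * z * (m * w) * (z⁻¹ * n⁻¹) * (w⁻¹ * m⁻¹)
          = n * (z * (m * w)) * z⁻¹ * n⁻¹ * w⁻¹ * m⁻¹ := by simp only [mul_assoc]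
        _ = n * m * (w * n⁻¹) * w⁻¹ * m⁻¹ := by
          rw [← hz']
          simp only [mul_assoc, mul_inv_cancel_left]
        _ = n * m * n⁻¹ * m⁻¹ := by
          rw [← hw']
          simp only [mul_assoc, mul_inv_cancel_left]
    rw [this]
    exact mul_mem (mul_mem (mul_mem hn hm) (inv_mem hn)) (inv_mem hm)

theorem IsQuasisimple.not_comm (h : IsQuasisimple X) : ¬ ∀ a b : X, a * b = b * a := by
  intro hc
  obtain ⟨a, b, hab⟩ := h.2.2
  induction a using QuotientGroup.induction_on
  induction b using QuotientGroup.induction_on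
  exact hab (by rw [← QuotientGroup.mk_mul, hc, QuotientGroup.mk_mul])

theorem IsQuasisimple.of_equiv (h : IsQuasisimple X) (e : X ≃* Y) : IsQuasisimple Y := by
  obtain ⟨h₁, h₂, a, b, hab⟩ := h
  have hc : (center X).map e.toMonoidHom = center Y := by
    ext y
    simp only [Subgroup.mem_map, Subgroup.mem_center_iff]
    constructor
    · rintro ⟨x, hx, rfl⟩ z
      have := congrArg e (hx (e.symm z))
      simpa using this
    · intro hy
      refine ⟨e.symm y, fun z => e.injective ?_, by simp⟩
      simpa using hy (e z)
  let e' : X ⧸ center X ≃* Y ⧸ center Y := QuotientGroup.congr _ _ e hc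
  refine ⟨?_, ?_, e' a, e' b, fun hh => hab (e'.injective (by simpa using hh))⟩
  · have := map_commutator (⊤ : Subgroup X) ⊤ e.toMonoidHom
    rw [← commutator_def, h₁, Subgroup.map_top_of_surjective _ e.surjective] at this
    rw [commutator_def, ← this]
  · exact e'.symm.isSimpleGroup

variable {G : Type} [Group G]

theorem IsQuasisimple.commutator_self {L : Subgroup G} (h : IsQuasisimple L) : ⁅L, L⁆ = L :=
  Subgroup.isPerfect_iff.1 ⟨h.1⟩

theorem IsQuasisimple.commutator_eq_bot_of_normIn {L N : Subgroup G} (h : IsQuasisimple L)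
    (hN : NormIn N L) (hne : ¬ L ≤ N) : ⁅L, N⁆ = ⊥ := by
  have := hN.normal
  have hc : N.subgroupOf L ≤ center L :=
    h.le_center fun ht => hne (Subgroup.subgroupOf_eq_top.1 ht)
  rw [eq_bot_iff, Subgroup.commutator_le]
  intro l hl n hn
  have := Subgroup.mem_center_iff.1 (@hc ⟨n, hN.1 hn⟩ hn) ⟨l, hl⟩
  exact commutatorElement_eq_one_iff_mul_comm.2 (congrArg Subtype.val this)

theorem IsQuasisimple.not_commutator_self {L : Subgroup G} (h : IsQuasisimple L) :
    ⁅L, L⁆ ≠ ⊥ := by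
  intro hb
  refine h.not_comm fun a b => Subtype.ext ?_
  have := Subgroup.commutator_mem_commutator a.2 b.2
  rw [hb] at this
  exact commutatorElement_eq_one_iff_mul_comm.1 this

theorem IsQuasisimple.commutator_normal_eq_bot {L D : Subgroup G} (h : IsQuasisimple L)
    (hL : Sn L D) {N : Subgroup G} (hN : NormIn N D) (hne : ¬ L ≤ N) : ⁅L, N⁆ = ⊥ := by
  induction hL generalizing N with
  | refl => exact h.commutator_eq_bot_of_normIn hN hne
  | @tail M D hL hM ih =>
    have hLM : L ≤ M := Sn.le hL
    have hMN : NormIn (N ⊓ M) M := by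
      simpa [inf_eq_right.2 hM.1] using hN.inf_right M
    have hb := ih hMN fun hle => hne (hle.trans inf_le_left)
    have hle : ⁅L, N⁆ ≤ N ⊓ M := by
      rw [Subgroup.commutator_le]
      intro l hl n hn
      refine ⟨?_, ?_⟩
      · exact N.mul_mem (hN.conj_mem (hM.1 (hLM hl)) hn) (N.inv_mem hn)
      · rw [commutatorElement_def, mul_assoc, mul_assoc, ← mul_assoc n]
        exact M.mul_mem (hLM hl) (hM.conj_mem (hN.1 hn) (M.inv_mem (hLM hl)))
    have h₁ : ⁅⁅L, N⁆, L⁆ = ⊥ := by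
      rw [Subgroup.commutator_comm, eq_bot_iff, ← hb]
      exact Subgroup.commutator_mono le_rfl hle
    have h₂ : ⁅⁅N, L⁆, L⁆ = ⊥ := by rwa [Subgroup.commutator_comm N L]
    have := Subgroup.commutator_commutator_eq_bot_of_rotate h₁ h₂
    rwa [h.commutator_self] at this

theorem IsQuasisimple.commutator_sn_eq_bot {L N D : Subgroup G} (h : IsQuasisimple L)
    (hL : Sn L D) (hN : Sn N D) (hne : ¬ L ≤ N) : ⁅L, N⁆ = ⊥ := by
  induction hN with
  | refl => exact absurd hL.le hne
  | @tail M D hN hM ih =>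
    by_cases hLM : L ≤ M
    · exact ih (hL.of_le hLM hM.1)
    · rw [eq_bot_iff, ← h.commutator_normal_eq_bot hL hM hLM]
      exact Subgroup.commutator_mono le_rfl (Sn.le hN)

/-- Distinct components commute. -/
theorem IsComponent.commutator_eq_bot {K L : Subgroup G} (hK : IsComponent K)
    (hL : IsComponent L) (hne : K ≠ L) : ⁅K, L⁆ = ⊥ := by
  have hK' := isSubnormal_iff_sn.1 hK.1
  have hL' := isSubnormal_iff_sn.1 hL.1
  by_cases hle : K ≤ L
  · rw [Subgroup.commutator_comm]
    exact hL.2.commutator_sn_eq_bot hL' hK' fun h => hne (le_antisymm hle h)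
  · exact hK.2.commutator_sn_eq_bot hK' hL' hle

theorem IsComponent.le_centralizer {K L : Subgroup G} (hK : IsComponent K)
    (hL : IsComponent L) (hne : K ≠ L) : K ≤ centralizer (L : Set G) :=
  Subgroup.commutator_eq_bot_iff_le_centralizer.1 (hK.commutator_eq_bot hL hne)

theorem IsQuasisimple.not_le_centralizer {L : Subgroup G} (h : IsQuasisimple L) :
    ¬ L ≤ centralizer (L : Set G) := fun hle =>
  h.not_commutator_self (Subgroup.commutator_eq_bot_iff_le_centralizer.2 hle)

theorem IsComponent.map_equiv {K : Subgroup X} (hK : IsComponent K) (e : X ≃* Y) :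
    IsComponent (K.map e.toMonoidHom) := by
  refine ⟨isSubnormal_iff_sn.2 ?_, hK.2.of_equiv (e.subgroupMap K)⟩
  have := (isSubnormal_iff_sn.1 hK.1).map e.toMonoidHom
  rwa [Subgroup.map_top_of_surjective _ e.surjective] at this

end Quasisimple

section Classes

/-- The groups which satisfy `P` or are trivial. -/
def OrTrivial (P : (X : Type) → [inst : Group X] → Prop) (X : Type) [Group X] : Prop :=
  P X ∨ Subsingleton X

/-- A class of groups that contains the trivial groups and is closed under subgroups, quotients
and products of two normal subgroups. -/
structure IsNormalProductClass (Q : (X : Type) → [inst : Group X] → Prop) : Prop where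
  of_subsingleton : ∀ (X : Type) [Group X] [Subsingleton X], Q X
  of_injective : ∀ {X Y : Type} [Group X] [Group Y] [Finite Y] (f : X →* Y),
    Function.Injective f → Q Y → Q X
  of_surjective : ∀ {X Y : Type} [Group X] [Group Y] [Finite X] (f : X →* Y),
    Function.Surjective f → Q X → Q Y
  sup : ∀ {X : Type} [Group X] [Finite X] (M N : Subgroup X) [M.Normal] [N.Normal],
    Q ↥M → Q ↥N → Q ↥(M ⊔ N)

theorem isNormalProductClass_orTrivial {P : (X : Type) → [inst : Group X] → Prop}
    (hIso : ∀ (X Y : Type) [Group X] [Group Y] [Finite X], Nonempty (X ≃* Y) → P X → P Y)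
    (hSubClosed : ∀ (X : Type) [Group X] [Finite X], P X → ∀ H : Subgroup X, P ↥H)
    (hQuotClosed : ∀ (X : Type) [Group X] [Finite X], P X →
      ∀ (N : Subgroup X) [N.Normal], P (X ⧸ N))
    (hJoinClosed : ∀ (X : Type) [Group X] [Finite X] (M N : Subgroup X) [M.Normal] [N.Normal],
      P ↥M → P ↥N → P ↥(M ⊔ N)) : IsNormalProductClass (OrTrivial P) where
  of_subsingleton X _ h := Or.inr h
  of_injective f hf h := h.imp
    (fun h => hIso _ _ ⟨(MonoidHom.ofInjective hf).symm⟩ (hSubClosed _ h f.range))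
    fun h => @Function.Injective.subsingleton _ _ _ hf h
  of_surjective f hf h := h.imp
    (fun h => hIso _ _ ⟨QuotientGroup.quotientKerEquivOfSurjective f hf⟩ (hQuotClosed _ h f.ker))
    fun h => @Function.Surjective.subsingleton _ _ _ h hf
  sup M N _ _ hM hN := by
    rcases hM with hM | hM
    · rcases hN with hN | hN
      · exact Or.inl (hJoinClosed _ M N hM hN)
      · rw [N.eq_bot_of_subsingleton, sup_bot_eq]
        exact Or.inl hM
    · rw [M.eq_bot_of_subsingleton, bot_sup_eq]
      exact hN

/-- A group without nontrivial homomorphisms to finite groups in the class `Q`. -/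
def QPerfect (Q : (X : Type) → [inst : Group X] → Prop) (X : Type) [Group X] : Prop :=
  ∀ (Y : Type) [Group Y] [Finite Y], Q Y → ∀ (f : X →* Y) (x : X), f x = 1

theorem QPerfect.of_surjective {Q : (X : Type) → [inst : Group X] → Prop} {X Y : Type} [Group X]
    [Group Y] (h : QPerfect Q X) (f : X →* Y) (hf : Function.Surjective f) : QPerfect Q Y := by
  intro Z _ _ hZ g y
  obtain ⟨x, rfl⟩ := hf y
  exact h Z hZ (g.comp f) x

theorem QPerfect.iSup {Q : (X : Type) → [inst : Group X] → Prop} {G : Type} [Group G] {ι : Type}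
    {L : ι → Subgroup G} (h : ∀ i, QPerfect Q ↥(L i)) : QPerfect Q ↥(⨆ i, L i) := by
  intro Y _ _ hY f
  have hle : ⨆ i, L i ≤ f.ker.map (⨆ i, L i).subtype := by
    refine iSup_le fun i x hx => ⟨⟨x, le_iSup L i hx⟩, ?_, rfl⟩
    exact h i Y hY (f.comp (Subgroup.inclusion (le_iSup L i))) ⟨x, hx⟩
  rintro ⟨x, hx⟩
  obtain ⟨y, hy, rfl⟩ := hle hx
  exact hy

variable {P : (X : Type) → [inst : Group X] → Prop} (hQ : IsNormalProductClass (OrTrivial P))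
include hQ

theorem oup_eq_top_iff {X : Type} [Group X] [Finite X] :
    Oup P X = ⊤ ↔ QPerfect (OrTrivial P) X := by
  constructor
  · intro h Y _ _ hY f x
    have hr : OrTrivial P (X ⧸ f.ker) :=
      hQ.of_injective (QuotientGroup.kerLift f) (QuotientGroup.kerLift_injective f) hY
    have hker : f.ker = ⊤ := by
      rcases hr with hr | hr
      · exact top_le_iff.1 (h ▸ iInf₂_le f.ker ⟨inferInstance, hr⟩)
      · exact QuotientGroup.subsingleton_iff.1 hr
    exact (hker ▸ mem_top x : x ∈ f.ker)
  · intro h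
    refine top_le_iff.1 (le_iInf₂ fun N hN x _ => ?_)
    obtain ⟨hN, hP⟩ := hN
    exact (QuotientGroup.eq_one_iff x).1 (h (X ⧸ N) (Or.inl hP) (QuotientGroup.mk' N) x)

theorem orTrivial_op (X : Type) [Group X] [Finite X] : OrTrivial P (Op P X) := by
  have h : Op P X = ⨆ N : {N : Subgroup X // N.Normal ∧ P ↥N}, (N : Subgroup X) := by
    simp [Op, genBy, Subgroup.closure_iUnion, iSup_subtype]
  rw [h]
  refine (iSup_of_sup (p := fun N : Subgroup X => N.Normal ∧ OrTrivial P ↥N)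
    ⟨inferInstance, hQ.of_subsingleton _⟩ ?_ fun N => ⟨N.2.1, Or.inl N.2.2⟩).2
  rintro M N ⟨hM, hM'⟩ ⟨hN, hN'⟩
  exact ⟨inferInstance, hQ.sup M N hM' hN'⟩

omit hQ in
theorem le_op {X : Type} [Group X] {N : Subgroup X} (hN : N.Normal) (h : OrTrivial P ↥N) :
    N ≤ Op P X := by
  rcases h with h | h
  · have hmem : N ∈ {N : Subgroup X | N.Normal ∧ P ↥N} := ⟨hN, h⟩
    exact fun x hx => Subgroup.subset_closure (Set.mem_biUnion hmem hx)
  · rw [N.eq_bot_of_subsingleton]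
    exact bot_le

variable {G : Type} [Group G]

/-- `O_𝒫(H)`, as a subgroup of the ambient group. -/
def OpIn (P : (X : Type) → [inst : Group X] → Prop) (H : Subgroup G) : Subgroup G :=
  (Op P H).map H.subtype

omit hQ in
theorem normIn_opIn (H : Subgroup G) : NormIn (OpIn P H) H := by
  have := (normIn_top_iff.2 (Op_normal P H)).map H.subtype
  rwa [← MonoidHom.range_eq_map, Subgroup.range_subtype] at this

omit hQ in
theorem mem_opIn {H : Subgroup G} {x : H} : (x : G) ∈ OpIn P H ↔ x ∈ Op P H := by
  simp [OpIn]

variable [Finite G]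

theorem orTrivial_opIn (H : Subgroup G) : OrTrivial P (OpIn P H) :=
  hQ.of_surjective (H.subtype.subgroupMap (Op P H)) (H.subtype.subgroupMap_surjective _)
    (orTrivial_op hQ H)

theorem orTrivial_of_le {H K : Subgroup G} (h : H ≤ K) (hK : OrTrivial P K) : OrTrivial P H :=
  hQ.of_injective (Subgroup.inclusion h) (Subgroup.inclusion_injective h) hK

theorem le_opIn {S H : Subgroup G} (hS : NormIn S H) (h : OrTrivial P S) : S ≤ OpIn P H := by
  intro x hx
  refine ⟨⟨x, hS.1 hx⟩, le_op hS.normal ?_ hx, rfl⟩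
  exact hQ.of_injective (Subgroup.subgroupOfEquivOfLe hS.1).toMonoidHom
    (Subgroup.subgroupOfEquivOfLe hS.1).injective h

theorem opIn_map_le (H : Subgroup G) (e : G ≃* G) :
    (OpIn P H).map e.toMonoidHom ≤ OpIn P (H.map e.toMonoidHom) :=
  le_opIn hQ ((normIn_opIn H).map _) <|
    hQ.of_surjective (e.toMonoidHom.subgroupMap _) (e.toMonoidHom.subgroupMap_surjective _)
      (orTrivial_opIn hQ H)

theorem Sn.opIn_le {H D : Subgroup G} (h : Sn H D) : OpIn P H ≤ OpIn P D := by
  induction h with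
  | refl => exact le_rfl
  | @tail M D _ hM ih =>
    refine ih.trans (le_opIn hQ ⟨(normIn_opIn M).1.trans hM.1, ?_⟩ (orTrivial_opIn hQ M))
    rw [le_normalizer_iff_map]
    intro d hd
    refine (opIn_map_le hQ M (MulAut.conj d)).trans ?_
    rw [hM.map_conj_eq hd]

theorem Sn.opIn_eq {H D : Subgroup G} (h : Sn H D) : OpIn P H = H ⊓ OpIn P D := by
  refine le_antisymm (le_inf (normIn_opIn H).1 (h.opIn_le hQ)) (le_opIn hQ ?_ ?_)
  · simpa [inf_eq_right.2 h.le, inf_comm] using (normIn_opIn (P := P) D).inf_right H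
  · exact orTrivial_of_le hQ inf_le_right (orTrivial_opIn hQ D)

/-- If `L` is normal in `D = LR` with `R` in the class, then `D / L` is in the class, so `L`
contains the image of every homomorphism from a `QPerfect` group to `D`. -/
theorem NormIn.mem_of_qPerfect {L D R : Subgroup G} (hL : NormIn L D) (hRD : R ≤ D)
    (hR : OrTrivial P R) (hD : D ≤ L ⊔ R) {X : Type} [Group X] (hX : QPerfect (OrTrivial P) X)
    (f : X →* D) (x : X) : (f x : G) ∈ L := by
  have := hL.normal
  let q := QuotientGroup.mk' (L.subgroupOf D)
  have hs : Function.Surjective (q.comp (Subgroup.inclusion hRD)) := by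
    intro y
    obtain ⟨⟨d, hd⟩, rfl⟩ := QuotientGroup.mk'_surjective _ y
    have hmem : (⟨d, hd⟩ : D) ∈ L.subgroupOf D ⊔ R.subgroupOf D := by
      rw [← Subgroup.subgroupOf_sup hL.1 hRD]
      exact hD hd
    obtain ⟨l, hl, r, hr, hlr⟩ := Subgroup.mem_sup_of_normal_left.1 hmem
    refine ⟨⟨r, Subgroup.mem_subgroupOf.1 hr⟩, ?_⟩
    have hl' : q l = 1 := (QuotientGroup.eq_one_iff l).2 hl
    change q r = q ⟨d, hd⟩
    rw [← hlr, map_mul, hl', one_mul]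
  exact (QuotientGroup.eq_one_iff (f x)).1
    (hX _ (hQ.of_surjective _ hs hR) (q.comp f) x)

theorem QPerfect.normIn {L D R : Subgroup G} (hL : QPerfect (OrTrivial P) L) (hLD : Sn L D)
    (hRD : NormIn R D) (hR : OrTrivial P R) (hD : D ≤ L ⊔ R) : NormIn L D := by
  induction hLD generalizing R with
  | refl => exact ⟨le_rfl, le_normalizer⟩
  | @tail N D hLN hN ih =>
    have hLN' : L ≤ N := Sn.le hLN
    have hR' : OrTrivial P ↥(R ⊓ N) := orTrivial_of_le hQ inf_le_left hR
    have hRN : NormIn (R ⊓ N) N := by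
      simpa [inf_eq_right.2 hN.1] using hRD.inf_right N
    have hNL : N ≤ L ⊔ (R ⊓ N) := by
      intro n hn
      have : n ∈ ((L ⊔ R : Subgroup G) : Set G) := hD (hN.1 hn)
      rw [coe_mul_of_left_le_normalizer_right L R ((hLN'.trans hN.1).trans hRD.2)] at this
      obtain ⟨l, hl, r, hr, rfl⟩ := this
      exact mul_mem_sup hl ⟨hr, (N.mul_mem_cancel_left (hLN' hl)).1 hn⟩
    have hLN'' := ih hRN hR' hNL
    refine ⟨hLN'.trans hN.1, le_normalizer_iff.2 fun d hd l hl => ?_⟩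
    have hmem : ∀ l : L, (MulAut.conj d).toMonoidHom.comp L.subtype l ∈ N := fun l =>
      hN.conj_mem hd (hLN' l.2)
    exact hLN''.mem_of_qPerfect hQ hRN.1 hR' hNL hL
      (((MulAut.conj d).toMonoidHom.comp L.subtype).codRestrict N hmem) ⟨l, hl⟩

end Classes

section Covering

variable {G Y : Type} [Group G] [Group Y] {K : Subgroup G} (φ : ↥K →* Y)

/-- The image in `Y` of `L ⊓ K`. -/
def imageOf (L : Subgroup G) : Subgroup Y :=
  (L.subgroupOf K).map φ

/-- The preimage of `C` in `K`, as a subgroup of `G`. -/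
def preimageOf (C : Subgroup Y) : Subgroup G :=
  (C.comap φ).map K.subtype

variable {φ}

theorem preimageOf_le (C : Subgroup Y) : preimageOf φ C ≤ K :=
  Subgroup.map_subtype_le _

theorem le_preimageOf_iff {L : Subgroup G} (hL : L ≤ K) {C : Subgroup Y} :
    L ≤ preimageOf φ C ↔ imageOf φ L ≤ C := by
  rw [imageOf, Subgroup.map_le_iff_le_comap]
  constructor
  · intro h x hx
    obtain ⟨y, hy, hyx⟩ := h hx
    rwa [← Subtype.ext hyx]
  · exact fun h x hx => ⟨⟨x, hL hx⟩, @h ⟨x, hL hx⟩ hx, rfl⟩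

theorem imageOf_preimageOf (hφ : Function.Surjective φ) (C : Subgroup Y) :
    imageOf φ (preimageOf φ C) = C := by
  rw [imageOf, preimageOf, Subgroup.subgroupOf, Subgroup.comap_map_eq_self_of_injective
    K.subtype_injective, Subgroup.map_comap_eq_self_of_surjective hφ]

theorem imageOf_self (hφ : Function.Surjective φ) : imageOf φ K = ⊤ := by
  rw [imageOf, Subgroup.subgroupOf_self, Subgroup.map_top_of_surjective _ hφ]

theorem NormIn.imageOf {M L : Subgroup G} (h : NormIn M L) :
    NormIn (imageOf φ M) (imageOf φ L) :=
  (h.comap K.subtype).map φ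

theorem Sn.imageOf {M L : Subgroup G} (h : Sn M L) : Sn (imageOf φ M) (imageOf φ L) :=
  (h.comap K.subtype).map φ

theorem Sn.preimageOf {C : Subgroup Y} (h : Sn C ⊤) : Sn (preimageOf φ C) K := by
  have := (h.comap φ).map K.subtype
  rwa [Subgroup.comap_top, ← MonoidHom.range_eq_map, Subgroup.range_subtype] at this

variable {P : (X : Type) → [inst : Group X] → Prop}

theorem le_sup_opIn (hker : φ.ker = Op P K) {L D : Subgroup G} (hD : D ≤ K)
    (h : imageOf φ D ≤ imageOf φ L) : D ≤ L ⊔ OpIn P K := by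
  intro d hd
  obtain ⟨l, hl, hld⟩ := h ⟨⟨d, hD hd⟩, hd, rfl⟩
  have hmem : l⁻¹ * ⟨d, hD hd⟩ ∈ Op P K := by
    rw [← hker, MonoidHom.mem_ker, map_mul, map_inv, hld, inv_mul_cancel]
  have := mul_mem_sup (Subgroup.mem_subgroupOf.1 hl) (mem_opIn.2 hmem)
  simpa using this

variable [Finite G] (hQ : IsNormalProductClass (OrTrivial P))
include hQ

theorem isQuasisimple_imageOf_iff (hker : φ.ker = Op P K) {L : Subgroup G} (hL : Sn L K) :
    IsQuasisimple (imageOf φ L) ↔ IsQuasisimple (L ⧸ Op P L) := by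
  let θ := φ.comp (Subgroup.inclusion hL.le)
  have hθ : θ.ker = Op P L := by
    ext x
    rw [← mem_opIn, hL.opIn_eq hQ, Subgroup.mem_inf, MonoidHom.mem_ker]
    change φ (Subgroup.inclusion hL.le x) = 1 ↔ _
    rw [← MonoidHom.mem_ker, hker, ← mem_opIn]
    simp
  have hr : θ.range = imageOf φ L := by
    rw [MonoidHom.range_comp, Subgroup.inclusion_range, imageOf]
  let e : L ⧸ Op P L ≃* imageOf φ L :=
    ((QuotientGroup.quotientMulEquivOfEq hθ.symm).trans
      (QuotientGroup.quotientKerEquivRange θ)).trans (MulEquiv.subgroupCongr hr)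
  exact ⟨fun h => h.of_equiv e.symm, fun h => h.of_equiv e⟩

theorem QPerfect.le_of_imageOf_le (hker : φ.ker = Op P K) {L M : Subgroup G}
    (hL : QPerfect (OrTrivial P) L) (hLK : Sn L K) (hM : QPerfect (OrTrivial P) M) (hMK : M ≤ K)
    (h : imageOf φ M ≤ imageOf φ L) : M ≤ L := by
  set D := PaperPF.preimageOf φ (imageOf φ L)
  have hDK : D ≤ K := preimageOf_le _
  have hLD : L ≤ D := (le_preimageOf_iff hLK.le).2 le_rfl
  have hMD : M ≤ D := (le_preimageOf_iff hMK).2 h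
  have hRD : OpIn P K ≤ D := by
    refine (le_preimageOf_iff (normIn_opIn K).1).2 ?_
    rintro _ ⟨x, hx, rfl⟩
    have : x ∈ φ.ker := hker ▸ mem_opIn.1 hx
    rw [MonoidHom.mem_ker.1 this]
    exact one_mem _
  have hDLR : D ≤ L ⊔ OpIn P K :=
    le_sup_opIn hker hDK ((le_preimageOf_iff hDK).1 le_rfl)
  have hR := orTrivial_opIn hQ K
  have hn : NormIn L D := hL.normIn hQ (hLK.of_le hLD hDK)
    ⟨hRD, hDK.trans (normIn_opIn K).2⟩ hR hDLR
  exact fun x hx => hn.mem_of_qPerfect hQ hRD hR hDLR hM (Subgroup.inclusion hMD) ⟨x, hx⟩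

omit hQ in
theorem IsComponent.normal_of_sSup_eq_top {C : Subgroup Y} (hC : IsComponent C)
    (h : sSup {C : Subgroup Y | IsComponent C} = ⊤) : C.Normal := by
  rw [← Subgroup.normalizer_eq_top_iff, eq_top_iff, ← h, sSup_le_iff]
  intro D hD
  by_cases hDC : D = C
  · exact hDC ▸ le_normalizer
  · exact (hD.le_centralizer hC hDC).trans (Subgroup.centralizer_le_normalizer _)

omit hQ in
theorem IsComponent.sup_centralizer_eq_top {C : Subgroup Y} (hC : IsComponent C)
    (h : sSup {C : Subgroup Y | IsComponent C} = ⊤) : C ⊔ centralizer (C : Set Y) = ⊤ := by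
  rw [eq_top_iff, ← h, sSup_le_iff]
  intro D hD
  by_cases hDC : D = C
  · exact hDC ▸ le_sup_left
  · exact (hD.le_centralizer hC hDC).trans le_sup_right

/-- A component of `Y` is the image of a subnormal `QPerfect` subgroup. -/
theorem IsComponent.exists_qPerfect [Finite Y] (hφ : Function.Surjective φ)
    (hK : QPerfect (OrTrivial P) K) {C : Subgroup Y} (hC : IsComponent C)
    (h : sSup {C : Subgroup Y | IsComponent C} = ⊤) :
    ∃ L : Subgroup G, Sn L K ∧ QPerfect (OrTrivial P) L ∧ imageOf φ L = C := by
  obtain ⟨L, hL⟩ := (Set.toFinite {L : Subgroup G | Sn L K ∧ imageOf φ L = C}).exists_minimal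
    ⟨_, (isSubnormal_iff_sn.1 hC.1).preimageOf, imageOf_preimageOf hφ C⟩
  obtain ⟨⟨hLK, hLC⟩, hmin⟩ := hL
  refine ⟨L, hLK, ?_, hLC⟩
  intro Z _ _ hZ f
  set M := f.ker.map L.subtype
  have hML : NormIn M L := by
    have := (normIn_top_iff.2 f.normal_ker).map L.subtype
    rwa [← MonoidHom.range_eq_map, Subgroup.range_subtype] at this
  suffices hMC : C ≤ imageOf φ M by
    have hle : L ≤ M := hmin ⟨hML.sn.trans hLK,
      le_antisymm (hLC ▸ hML.imageOf.1) hMC⟩ hML.1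
    rintro ⟨x, hx⟩
    obtain ⟨y, hy, rfl⟩ := hle hx
    exact hy
  by_contra hMC
  have := hC.normal_of_sSup_eq_top h
  have hMZ : imageOf φ M ≤ centralizer (C : Set Y) := by
    rw [← Subgroup.commutator_eq_bot_iff_le_centralizer, Subgroup.commutator_comm]
    exact hC.2.commutator_eq_bot_of_normIn (hLC ▸ hML.imageOf) hMC
  let q := QuotientGroup.mk' (centralizer (C : Set Y))
  let g : L →* Y ⧸ centralizer (C : Set Y) := (q.comp φ).comp (Subgroup.inclusion hLK.le)
  have hg : ∀ x ∈ f.ker, g x = 1 := fun x hx =>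
    (QuotientGroup.eq_one_iff _).2 (hMZ ⟨Subgroup.inclusion hLK.le x, ⟨x, hx, rfl⟩, rfl⟩)
  have hgs : Function.Surjective (QuotientGroup.lift f.ker g hg) := by
    intro z
    obtain ⟨y, rfl⟩ := QuotientGroup.mk'_surjective _ z
    have hy : y ∈ C ⊔ centralizer (C : Set Y) := hC.sup_centralizer_eq_top h ▸ mem_top y
    obtain ⟨c, hc, w, hw, rfl⟩ := Subgroup.mem_sup_of_normal_right.1 hy
    rw [← hLC] at hc
    obtain ⟨⟨x, hxK⟩, hx, rfl⟩ := hc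
    refine ⟨((⟨x, hx⟩ : L) : L ⧸ f.ker), ?_⟩
    have hw' : q w = 1 := (QuotientGroup.eq_one_iff w).2 hw
    change q (φ ⟨x, hxK⟩) = q (φ ⟨x, hxK⟩ * w)
    rw [map_mul, hw', mul_one]
  have hquot : OrTrivial P (Y ⧸ centralizer (C : Set Y)) :=
    hQ.of_surjective _ hgs
      (hQ.of_injective (QuotientGroup.kerLift f) (QuotientGroup.kerLift_injective f) hZ)
  refine hC.2.not_le_centralizer fun y _ => ?_
  obtain ⟨x, rfl⟩ := hφ y
  exact (QuotientGroup.eq_one_iff _).1 (hK _ hquot (q.comp φ) x)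

end Covering

section Action

variable {A G Y : Type} [Group A] [Group G] [Group Y] [MulDistribMulAction A G]
  [MulDistribMulAction A Y]

theorem smul_eq_map (a : A) (L : Subgroup G) :
    a • L = L.map (MulDistribMulAction.toMulEquiv G a).toMonoidHom :=
  rfl

theorem IsComponent.smul {C : Subgroup G} (hC : IsComponent C) (a : A) : IsComponent (a • C) :=
  hC.map_equiv (MulDistribMulAction.toMulEquiv G a)

theorem Sn.smul_top {L : Subgroup G} (hL : Sn L ⊤) (a : A) : Sn (a • L) ⊤ := by
  have htop : (⊤ : Subgroup G).map (MulDistribMulAction.toMulEquiv G a).toMonoidHom = ⊤ :=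
    Subgroup.map_top_of_surjective _ (MulDistribMulAction.toMulEquiv G a).surjective
  exact htop ▸ hL.map (MulDistribMulAction.toMulEquiv G a).toMonoidHom

theorem QPerfect.smul {Q : (X : Type) → [inst : Group X] → Prop} {L : Subgroup G}
    (hL : QPerfect Q L) (a : A) : QPerfect Q ↥(a • L) :=
  hL.of_surjective (Subgroup.equivSMul a L).toMonoidHom (Subgroup.equivSMul a L).surjective

theorem smul_iSup_smul (L : Subgroup G) (a : A) : a • (⨆ b : A, b • L) = ⨆ b : A, b • L := by
  rw [smul_eq_map, Subgroup.map_iSup]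
  exact (Equiv.mulLeft a).iSup_congr fun b => mul_smul a b L

theorem smul_eq_of_smul_mem {K : Subgroup G} (hK : ∀ (a : A) (x : G), x ∈ K → a • x ∈ K)
    (a : A) : a • K = K := by
  have h : ∀ a : A, a • K ≤ K := by
    rintro a _ ⟨x, hx, rfl⟩
    exact hK a x hx
  exact le_antisymm (h a) (Subgroup.subset_pointwise_smul_iff.2 (h a⁻¹))

variable (A) in
/-- `Y` is the quotient `K / O_𝒫(K)` with its induced action of `A`. -/
structure IsRadicalQuotient (P : (X : Type) → [inst : Group X] → Prop) {K : Subgroup G}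
    (φ : ↥K →* Y) : Prop where
  surjective : Function.Surjective φ
  ker_eq : φ.ker = Op P K
  smul_mem : ∀ (a : A) (x : G), x ∈ K → a • x ∈ K
  map_smul : ∀ (a : A) (x : K), φ ⟨a • (x : G), smul_mem a x x.2⟩ = a • φ x

namespace IsRadicalQuotient

variable {P : (X : Type) → [inst : Group X] → Prop} {K : Subgroup G} {φ : ↥K →* Y}
  (hφ : IsRadicalQuotient A P φ)
include hφ

theorem smul_eq (a : A) : a • K = K :=
  smul_eq_of_smul_mem hφ.smul_mem a

theorem smul_le {L : Subgroup G} (hL : L ≤ K) (a : A) : a • L ≤ K :=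
  (Subgroup.pointwise_smul_le_pointwise_smul_iff.2 hL).trans (hφ.smul_eq a).le

theorem smul_sn {L : Subgroup G} (hL : Sn L K) (a : A) : Sn (a • L) K := by
  have := hL.map (MulDistribMulAction.toMulEquiv G a).toMonoidHom
  rwa [← smul_eq_map, ← smul_eq_map, hφ.smul_eq] at this

theorem imageOf_smul {L : Subgroup G} (hL : L ≤ K) (a : A) :
    imageOf φ (a • L) = a • imageOf φ L := by
  refine le_antisymm ?_ ?_
  · rintro _ ⟨⟨_, _⟩, ⟨x, hx, rfl⟩, rfl⟩
    exact ⟨φ ⟨x, hL hx⟩, ⟨⟨x, hL hx⟩, hx, rfl⟩, (hφ.map_smul a ⟨x, hL hx⟩).symm⟩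
  · rintro _ ⟨_, ⟨x, hx, rfl⟩, rfl⟩
    exact ⟨_, ⟨(x : G), hx, rfl⟩, hφ.map_smul a x⟩

theorem eq_top_of_smul_imageOf_le {L : Subgroup G} (hL : L ≤ K) (hK : K = ⨆ a : A, a • L)
    {T : Subgroup Y} (hT : ∀ a : A, a • imageOf φ L ≤ T) : T = ⊤ := by
  rw [eq_top_iff, ← imageOf_self hφ.surjective, ← le_preimageOf_iff le_rfl]
  calc K = ⨆ a : A, a • L := hK
    _ ≤ preimageOf φ T := iSup_le fun a =>
      (le_preimageOf_iff (hφ.smul_le hL a)).2 (hφ.imageOf_smul hL a ▸ hT a)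

variable [Finite G] (hQ : IsNormalProductClass (OrTrivial P))
include hQ

theorem isComponent_imageOf {L : Subgroup G} (hL : IsPComponent P L) (hLK : L ≤ K) :
    IsComponent (imageOf φ L) := by
  have hS : Sn L K := (isSubnormal_iff_sn.1 hL.1).of_le hLK le_top
  refine ⟨isSubnormal_iff_sn.2 ?_, (isQuasisimple_imageOf_iff hQ hφ.ker_eq hS).2 hL.2.1⟩
  exact imageOf_self hφ.surjective ▸ hS.imageOf

theorem exists_smul_imageOf_eq {L : Subgroup G} (hL : IsPComponent P L)
    (hK : K = ⨆ a : A, a • L) {C : Subgroup Y} (hC : IsComponent C) :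
    ∃ a : A, a • imageOf φ L = C := by
  have hLK : L ≤ K := by simpa [← hK] using le_iSup (fun a : A => a • L) 1
  by_contra! hne
  have := hφ.eq_top_of_smul_imageOf_le hLK hK fun a =>
    ((hφ.isComponent_imageOf hQ hL hLK).smul a).le_centralizer hC (hne a)
  exact hC.2.not_le_centralizer (this ▸ le_top)

theorem isAQuasisimple {L : Subgroup G} (hL : IsPComponent P L) (hK : K = ⨆ a : A, a • L) :
    IsAQuasisimple A Y := by
  have hLK : L ≤ K := by simpa [← hK] using le_iSup (fun a : A => a • L) 1
  have hc := hφ.isComponent_imageOf hQ hL hLK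
  refine ⟨⟨_, hc⟩, hφ.eq_top_of_smul_imageOf_le hLK hK fun a => le_sSup (hc.smul a), ?_⟩
  intro C D hC hD
  obtain ⟨a, rfl⟩ := hφ.exists_smul_imageOf_eq hQ hL hK hC
  obtain ⟨b, rfl⟩ := hφ.exists_smul_imageOf_eq hQ hL hK hD
  exact ⟨b * a⁻¹, by rw [smul_smul, inv_mul_cancel_right]⟩

theorem exists_smul_eq {L M : Subgroup G} (hL : IsPComponent P L) (hM : IsPComponent P M)
    (hKL : K = ⨆ a : A, a • L) (hKM : K = ⨆ a : A, a • M) : ∃ a : A, a • L = M := by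
  have hLK : L ≤ K := by simpa [← hKL] using le_iSup (fun a : A => a • L) 1
  have hMK : M ≤ K := by simpa [← hKM] using le_iSup (fun a : A => a • M) 1
  obtain ⟨a, ha⟩ := hφ.exists_smul_imageOf_eq hQ hL hKL (hφ.isComponent_imageOf hQ hM hMK)
  rw [← hφ.imageOf_smul hLK] at ha
  have hS : ∀ {N : Subgroup G}, IsPComponent P N → N ≤ K → Sn N K := fun hN hNK =>
    (isSubnormal_iff_sn.1 hN.1).of_le hNK le_top
  have hL' := ((oup_eq_top_iff hQ).1 hL.2.2).smul a
  have hM' := (oup_eq_top_iff hQ).1 hM.2.2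
  have hLa := hφ.smul_sn (hS hL hLK) a
  exact ⟨a, le_antisymm
    (hM'.le_of_imageOf_le hQ hφ.ker_eq (hS hM hMK) hL' hLa.le ha.le)
    (hL'.le_of_imageOf_le hQ hφ.ker_eq hLa hM' hMK ha.ge)⟩

theorem exists_isPComponent [Finite A] [Finite Y] (hK : Sn K ⊤) (hKp : QPerfect (OrTrivial P) K)
    (hY : IsAQuasisimple A Y) : ∃ L : Subgroup G, IsPComponent P L ∧ K = ⨆ a : A, a • L := by
  obtain ⟨⟨C, hC⟩, hsup, htrans⟩ := hY
  obtain ⟨L, hLK, hL, rfl⟩ := IsComponent.exists_qPerfect hQ hφ.surjective hKp hC hsup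
  refine ⟨L, ⟨isSubnormal_iff_sn.2 (hLK.trans hK),
    (isQuasisimple_imageOf_iff hQ hφ.ker_eq hLK).1 hC.2, (oup_eq_top_iff hQ).2 hL⟩, ?_⟩
  have hle : ⨆ a : A, a • L ≤ K := iSup_le fun a => hφ.smul_le hLK.le a
  have hS : Sn (⨆ a : A, a • L) K :=
    Sn.of_le (iSup_of_sup (p := fun N : Subgroup G => Sn N ⊤) (sn_bot _) (fun _ _ => Sn.sup)
      fun a => (hLK.trans hK).smul_top a) hle le_top
  refine le_antisymm ?_ hle
  refine (QPerfect.iSup fun a => hL.smul a).le_of_imageOf_le hQ hφ.ker_eq hS hKp le_rfl ?_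
  refine le_top.trans (hsup.ge.trans (sSup_le fun D hD => ?_))
  obtain ⟨a, rfl⟩ := htrans _ D hC hD
  rw [← hφ.imageOf_smul hLK.le]
  exact Subgroup.map_mono (Subgroup.comap_mono (le_iSup (fun a : A => a • L) a))

end IsRadicalQuotient

end Action

section Bridge

variable {P : (X : Type) → [inst : Group X] → Prop} {A G : Type} [Group A] [Group G]
  [Finite G] [MulDistribMulAction A G] (hQ : IsNormalProductClass (OrTrivial P))
include hQ

theorem smul_mem_op {K : Subgroup G} (hK : ∀ (a : A) (x : G), x ∈ K → a • x ∈ K) (a : A) (x : K)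
    (hx : x ∈ Op P K) : (⟨a • (x : G), hK a x x.2⟩ : K) ∈ Op P K := by
  have := opIn_map_le hQ K (MulDistribMulAction.toMulEquiv G a) ⟨x, mem_opIn.2 hx, rfl⟩
  rw [← smul_eq_map, smul_eq_of_smul_mem hK] at this
  exact mem_opIn.1 this

theorem IsAPComponent.exists_isRadicalQuotient {K : Subgroup G} (h : IsAPComponent P A K) :
    Sn K ⊤ ∧ QPerfect (OrTrivial P) K ∧
      ∃ _ : MulDistribMulAction A (K ⧸ Op P K), IsRadicalQuotient A P (QuotientGroup.mk' (Op P K)) ∧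
        IsAQuasisimple A (K ⧸ Op P K) := by
  obtain ⟨hs, hp, hK, hOp, hq⟩ := h
  let := invSubAction A K hK
  let := invQuotAction A (Op P K) hOp
  exact ⟨isSubnormal_iff_sn.1 hs, (oup_eq_top_iff hQ).1 hp, this,
    ⟨QuotientGroup.mk'_surjective _, QuotientGroup.ker_mk' _, hK, fun _ _ => rfl⟩, hq⟩

theorem IsPComponent.isAPComponent [Finite A] {L : Subgroup G} (hL : IsPComponent P L) :
    IsAPComponent P A (⨆ a : A, a • L) := by
  have hK : ∀ (a : A) (x : G), x ∈ ⨆ b : A, b • L → a • x ∈ ⨆ b : A, b • L := fun a x hx => by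
    rw [← smul_iSup_smul L a]
    exact Subgroup.smul_mem_pointwise_smul x a _ hx
  have hs := isSubnormal_iff_sn.1 hL.1
  have hp := (oup_eq_top_iff hQ).1 hL.2.2
  have hOp := smul_mem_op hQ hK
  refine ⟨isSubnormal_iff_sn.2 ?_, (oup_eq_top_iff hQ).2 (QPerfect.iSup fun a => hp.smul a),
    hK, hOp, ?_⟩
  · exact iSup_of_sup (p := fun N : Subgroup G => Sn N ⊤) (sn_bot _) (fun _ _ => Sn.sup)
      fun a => hs.smul_top a
  · let := invSubAction A _ hK
    let := invQuotAction A (Op P _) hOp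
    have hφ : IsRadicalQuotient A P (QuotientGroup.mk' (Op P ↥(⨆ a : A, a • L))) :=
      ⟨QuotientGroup.mk'_surjective _, QuotientGroup.ker_mk' _, hK, fun _ _ => rfl⟩
    exact hφ.isAQuasisimple hQ hL rfl

end Bridge

theorem statement_10
    (P : (X : Type) → [inst : Group X] → Prop)
    (hIso : ∀ (X Y : Type) [Group X] [Group Y] [Finite X], Nonempty (X ≃* Y) → P X → P Y)
    (hSubClosed : ∀ (X : Type) [Group X] [Finite X], P X → ∀ H : Subgroup X, P ↥H)
    (hQuotClosed : ∀ (X : Type) [Group X] [Finite X], P X → ∀ (N : Subgroup X) [N.Normal], P (X ⧸ N))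
    (hInfClosed : ∀ (X : Type) [Group X] [Finite X] (M N : Subgroup X) [M.Normal] [N.Normal],
      P (X ⧸ M) → P (X ⧸ N) → P (X ⧸ (M ⊓ N)))
    (hJoinClosed : ∀ (X : Type) [Group X] [Finite X] (M N : Subgroup X) [M.Normal] [N.Normal],
      P ↥M → P ↥N → P ↥(M ⊔ N))
    (A G : Type) [Group A] [Group G] [Finite A] [Finite G]
    [MulDistribMulAction A G] :
    (∀ L : Subgroup G, IsPComponent P L → IsAPComponent P A (⨆ a : A, a • L)) ∧
    (∀ K : Subgroup G, IsAPComponent P A K →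
      ∃ L : Subgroup G, IsPComponent P L ∧ K = ⨆ a : A, a • L) ∧
    (∀ L L' : Subgroup G, IsPComponent P L → IsPComponent P L' →
      (⨆ a : A, a • L) = (⨆ a : A, a • L') → ∃ a : A, a • L = L') := by
  have hQ := isNormalProductClass_orTrivial hIso hSubClosed hQuotClosed hJoinClosed
  refine ⟨fun L hL => hL.isAPComponent hQ, fun K hK => ?_, fun L L' hL hL' h => ?_⟩
  · obtain ⟨hs, hp, _, hφ, hY⟩ := hK.exists_isRadicalQuotient hQ
    exact hφ.exists_isPComponent hQ hs hp hY
  · obtain ⟨_, _, _, hφ, _⟩ := (hL.isAPComponent (A := A) hQ).exists_isRadicalQuotient hQ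
    exact hφ.exists_smul_eq hQ hL hL' rfl h

end PaperPF
end

section
/- Let r be a prime and A an elementary abelian r-group acting coprimely on the finite group G. If M and N are A-invariant normal subgroups of G such that C_M(A) and C_N(A) are 𝒫-groups, then C_{MN}(A) is a 𝒫-group. Consequently, the subgroup O_{n𝒫}(G) generated by all A-invariant normal subgroups N of G with C_N(A) a 𝒫-group satisfies: C_{O_{n𝒫}(G)}(A) is a 𝒫-group. -/
open Pointwise

namespace PaperPF
set_option linter.unusedVariables false

/-- In a coprime action of an `r`-group, the fixed points of a product of two invariant normal
subgroups factor through the fixed points of the factors. -/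
theorem exists_fixed_factorization {r : ℕ} (hr : r.Prime) {A G : Type} [Group A] [Group G]
    [Finite A] [Finite G] [MulDistribMulAction A G] (hA : IsPGroup r A)
    (hco : Nat.Coprime (Nat.card A) (Nat.card G)) {M N : Subgroup G} [N.Normal]
    (hMinv : ∀ (a : A) (x : G), x ∈ M → a • x ∈ M)
    (hNinv : ∀ (a : A) (x : G), x ∈ N → a • x ∈ N)
    {g : G} (hg : g ∈ M ⊔ N) (hgA : ∀ a : A, a • g = g) :
    ∃ m ∈ M ⊓ FixedPoints.subgroup A G, ∃ n ∈ N ⊓ FixedPoints.subgroup A G, m * n = g := by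
  obtain ⟨m₀, hm₀, n₀, hn₀, rfl⟩ := Subgroup.mem_sup_of_normal_right.mp hg
  have := Fact.mk hr
  suffices h : ∃ m ∈ M, m⁻¹ * (m₀ * n₀) ∈ N ∧ ∀ a : A, a • m = m by
    obtain ⟨m, hm, hn, hfix⟩ := h
    refine ⟨m, ⟨hm, hfix⟩, m⁻¹ * (m₀ * n₀), ⟨hn, fun a => ?_⟩, mul_inv_cancel_left _ _⟩
    rw [smul_mul', smul_inv', hfix a, hgA a]
  have hn₀' : m₀⁻¹ * (m₀ * n₀) ∈ N := by rwa [inv_mul_cancel_left]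
  by_cases hdvd : r ∣ Nat.card G
  · have hsub : Subsingleton A := by
      obtain ⟨k, hk⟩ := IsPGroup.iff_card.mp hA
      have hk0 : k = 0 := by
        by_contra hk0
        exact Nat.not_coprime_of_dvd_of_dvd hr.one_lt (hk ▸ dvd_pow_self r hk0) hdvd hco
      exact (Nat.card_eq_one_iff_unique.mp (by rw [hk, hk0, pow_zero])).1
    exact ⟨m₀, hm₀, hn₀', fun a => by rw [Subsingleton.elim a 1, one_smul]⟩
  let Ω := {m : G // m ∈ M ∧ m⁻¹ * (m₀ * n₀) ∈ N}
  let _ : MulAction A Ω :=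
    { smul := fun a m => ⟨a • m.1, hMinv a _ m.2.1, by
        have h := hNinv a _ m.2.2
        rwa [smul_mul', smul_inv', hgA a] at h⟩
      one_smul := fun m => Subtype.ext (one_smul A m.1)
      mul_smul := fun a b m => Subtype.ext (mul_smul a b m.1) }
  let e : ↥(M ⊓ N) ≃ Ω :=
    { toFun := fun x => ⟨m₀ * x.1, M.mul_mem hm₀ x.2.1, by
        rw [mul_inv_rev, mul_assoc]
        exact N.mul_mem (N.inv_mem x.2.2) hn₀'⟩
      invFun := fun m => ⟨m₀⁻¹ * m.1, M.mul_mem (M.inv_mem hm₀) m.2.1, by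
        have h := N.mul_mem hn₀' (N.inv_mem m.2.2)
        simpa [mul_assoc] using h⟩
      left_inv := fun x => Subtype.ext (inv_mul_cancel_left _ _)
      right_inv := fun m => Subtype.ext (mul_inv_cancel_left _ _) }
  have hΩ : ¬ r ∣ Nat.card Ω := fun h =>
    hdvd ((Nat.card_congr e ▸ h).trans (Subgroup.card_subgroup_dvd_card (M ⊓ N)))
  obtain ⟨m, hm⟩ := hA.nonempty_fixed_point_of_prime_not_dvd_card Ω hΩ
  exact ⟨m.1, m.2.1, m.2.2, fun a => congrArg Subtype.val (hm a)⟩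

/-- A group-theoretic property closed under quotients and extensions passes to a product of two
subgroups, one of which is normalized by the product. -/
theorem property_of_factorization {P : (X : Type) → [inst : Group X] → Prop}
    (hIso : ∀ (X Y : Type) [Group X] [Group Y] [Finite X], Nonempty (X ≃* Y) → P X → P Y)
    (hQuotClosed : ∀ (X : Type) [Group X] [Finite X], P X →
      ∀ (N : Subgroup X) [N.Normal], P (X ⧸ N))
    (hExtClosed : ∀ (X : Type) [Group X] [Finite X] (N : Subgroup X) [N.Normal],
      P ↥N → P (X ⧸ N) → P X)
    {G : Type} [Group G] [Finite G] {H K L : Subgroup G} (hK : K ≤ H) (hL : L ≤ H)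
    [(K.subgroupOf H).Normal] (hfac : ∀ g ∈ H, ∃ k ∈ K, ∃ l ∈ L, k * l = g)
    (hPK : P ↥K) (hPL : P ↥L) : P ↥H := by
  refine hExtClosed ↥H (K.subgroupOf H) ?_ ?_
  · exact hIso _ _ ⟨(Subgroup.subgroupOfEquivOfLe hK).symm⟩ hPK
  · let f : ↥L →* ↥H ⧸ K.subgroupOf H :=
      (QuotientGroup.mk' (K.subgroupOf H)).comp (Subgroup.inclusion hL)
    have hf : Function.Surjective f := by
      intro q
      obtain ⟨⟨g, hg⟩, rfl⟩ := QuotientGroup.mk'_surjective _ q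
      obtain ⟨k, hk, l, hl, rfl⟩ := hfac g hg
      refine ⟨⟨l, hl⟩, ?_⟩
      have h1 : (QuotientGroup.mk' (K.subgroupOf H)) ⟨k, hK hk⟩ = 1 :=
        (QuotientGroup.eq_one_iff _).mpr hk
      have h2 : (⟨k * l, hg⟩ : ↥H) = ⟨k, hK hk⟩ * ⟨l, hL hl⟩ := rfl
      rw [h2, map_mul, h1, one_mul]
      rfl
    exact hIso _ _ ⟨QuotientGroup.quotientKerEquivOfSurjective f hf⟩ (hQuotClosed _ hPL f.ker)

theorem genBy_eq_sSup {G : Type} [Group G] (S : Set (Subgroup G)) : genBy S = sSup S := by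
  simp only [genBy, Subgroup.closure_iUnion, Subgroup.closure_eq, sSup_eq_iSup]

theorem smul_mem_sup {A G : Type} [Monoid A] [Group G] [MulDistribMulAction A G]
    {M N : Subgroup G} (hMinv : ∀ (a : A) (x : G), x ∈ M → a • x ∈ M)
    (hNinv : ∀ (a : A) (x : G), x ∈ N → a • x ∈ N) (a : A) (x : G) (hx : x ∈ M ⊔ N) :
    a • x ∈ M ⊔ N := by
  have h : M ⊔ N ≤ (M ⊔ N).comap (MulDistribMulAction.toMonoidHom G a) :=
    sup_le (fun y hy => Subgroup.mem_sup_left (hMinv a y hy))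
      (fun y hy => Subgroup.mem_sup_right (hNinv a y hy))
  exact h hx

theorem statement_13
    (P : (X : Type) → [inst : Group X] → Prop)
    (hIso : ∀ (X Y : Type) [Group X] [Group Y] [Finite X], Nonempty (X ≃* Y) → P X → P Y)
    (hSubClosed : ∀ (X : Type) [Group X] [Finite X], P X → ∀ H : Subgroup X, P ↥H)
    (hQuotClosed : ∀ (X : Type) [Group X] [Finite X], P X → ∀ (N : Subgroup X) [N.Normal], P (X ⧸ N))
    (hExtClosed : ∀ (X : Type) [Group X] [Finite X] (N : Subgroup X) [N.Normal],
      P ↥N → P (X ⧸ N) → P X)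
    (hSolvP : ∀ (X : Type) [Group X] [Finite X], IsSolvable X → P X)
    (r : ℕ) (hr : r.Prime) (A G : Type) [CommGroup A] [Group G]
    [Finite A] [Finite G] [MulDistribMulAction A G]
    (helem : ∀ a : A, a ^ r = 1)
    (hco : Nat.Coprime (Nat.card A) (Nat.card G))
    (M N : Subgroup G) [M.Normal] [N.Normal]
    (hMinv : ∀ (a : A) (x : G), x ∈ M → a • x ∈ M)
    (hNinv : ∀ (a : A) (x : G), x ∈ N → a • x ∈ N)
    (hMP : P ↥(M ⊓ FixedPoints.subgroup A G))
    (hNP : P ↥(N ⊓ FixedPoints.subgroup A G)) :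
    P ↥((M ⊔ N) ⊓ FixedPoints.subgroup A G) ∧
    P ↥(OnP P A G ⊓ FixedPoints.subgroup A G) := by
  have hA : IsPGroup r A := fun a => ⟨1, by rw [pow_one, helem a]⟩
  have key : ∀ K L : Subgroup G, K.Normal → L.Normal →
      (∀ (a : A) (x : G), x ∈ K → a • x ∈ K) → (∀ (a : A) (x : G), x ∈ L → a • x ∈ L) →
      P ↥(K ⊓ FixedPoints.subgroup A G) → P ↥(L ⊓ FixedPoints.subgroup A G) →
      P ↥((K ⊔ L) ⊓ FixedPoints.subgroup A G) := by
    intro K L hK hL hKinv hLinv hKP hLP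
    have : ((K ⊓ FixedPoints.subgroup A G).subgroupOf
        ((K ⊔ L) ⊓ FixedPoints.subgroup A G)).Normal :=
      ⟨fun x hx g => ⟨hK.conj_mem _ hx.1 _,
        Subgroup.mul_mem _ (Subgroup.mul_mem _ g.2.2 hx.2) (Subgroup.inv_mem _ g.2.2)⟩⟩
    exact property_of_factorization hIso hQuotClosed hExtClosed
      (inf_le_inf_right _ le_sup_left) (inf_le_inf_right _ le_sup_right)
      (fun g hg => exists_fixed_factorization hr hA hco hKinv hLinv hg.1 hg.2) hKP hLP
  refine ⟨key M N inferInstance inferInstance hMinv hNinv hMP hNP, ?_⟩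
  rw [OnP, genBy_eq_sSup]
  set T : Set (Subgroup G) := {N : Subgroup G | N.Normal ∧
    (∀ (a : A) (x : G), x ∈ N → a • x ∈ N) ∧ P ↥(N ⊓ FixedPoints.subgroup A G)} with hT
  have hbot : (⊥ : Subgroup G) ∈ T := by
    refine ⟨inferInstance, fun a x hx => ?_, hSolvP _ ?_⟩
    · rw [Subgroup.mem_bot] at hx ⊢
      rw [hx, smul_one]
    · rw [bot_inf_eq]
      exact (inferInstance : Group.IsSolvable ↥(⊥ : Subgroup G))
  have hsup : ∀ K ∈ T, ∀ L ∈ T, K ⊔ L ∈ T := by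
    rintro K ⟨hK, hKinv, hKP⟩ L ⟨hL, hLinv, hLP⟩
    exact ⟨Subgroup.sup_normal K L, smul_mem_sup hKinv hLinv,
      key K L hK hL hKinv hLinv hKP hLP⟩
  have hmem : ∀ S : Set (Subgroup G), S ⊆ T → sSup S ∈ T := by
    intro S hS
    induction S, S.toFinite using Set.Finite.induction_on with
    | empty => rwa [sSup_empty]
    | insert _ _ ih =>
      rw [sSup_insert]
      exact hsup _ (hS (Set.mem_insert _ _)) _ (ih ((Set.subset_insert _ _).trans hS))
  exact (hmem T subset_rfl).2.2

end PaperPF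
end

section
/- Let G be a finite group and H a subgroup of G with O_{𝒫,E}(G) ≤ H. Then O_{𝒫,E}(H) = O_{𝒫,E}(G). -/
open Pointwise

namespace PaperPF
set_option linter.unusedVariables false

/-- A property of finite groups that is invariant under isomorphism, closed under subgroups,
quotients and extensions, and satisfied by every finite solvable group. -/
structure ClosedProperty (P : (X : Type) → [inst : Group X] → Prop) : Prop where
  iso : ∀ (X Y : Type) [Group X] [Group Y] [Finite X], Nonempty (X ≃* Y) → P X → P Y
  sub : ∀ (X : Type) [Group X] [Finite X], P X → ∀ H : Subgroup X, P ↥H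
  quot : ∀ (X : Type) [Group X] [Finite X], P X → ∀ (N : Subgroup X) [N.Normal], P (X ⧸ N)
  ext : ∀ (X : Type) [Group X] [Finite X] (N : Subgroup X) [N.Normal],
    P ↥N → P (X ⧸ N) → P X
  solv : ∀ (X : Type) [Group X] [Finite X], Group.IsSolvable X → P X

theorem isSubnormal_iff {G : Type} [Group G] {K : Subgroup G} :
    IsSubnormal K ↔ K.IsSubnormal := by
  constructor
  · rintro ⟨n, c, rfl, hlast, hc⟩
    have h : ∀ i, (c i).IsSubnormal := fun i => by
      induction i using Fin.reverseInduction with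
      | last => rw [hlast]; exact .top
      | cast i ih => exact .step _ _ (hc i).1 ih (hc i).2
    exact h 0
  · intro h
    obtain ⟨n, f, hf, hN, h0, hn⟩ := h.exists_chain
    exact ⟨n, fun i => f i, by simpa using h0, by simpa using hn,
      fun i => ⟨hf (by simp), by simpa using hN i⟩⟩

theorem commutator_commutator_le_of_rotate {G : Type} [Group G] {A B C R : Subgroup G}
    [R.Normal] (h₁ : ⁅⁅B, C⁆, A⁆ ≤ R) (h₂ : ⁅⁅C, A⁆, B⁆ ≤ R) : ⁅⁅A, B⁆, C⁆ ≤ R := by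
  have key : ∀ L : Subgroup G, L ≤ R ↔ L.map (QuotientGroup.mk' R) = ⊥ := fun L => by
    rw [Subgroup.map_eq_bot_iff, QuotientGroup.ker_mk']
  rw [key, Subgroup.map_commutator, Subgroup.map_commutator] at h₁ h₂ ⊢
  exact Subgroup.commutator_commutator_eq_bot_of_rotate h₁ h₂

/-- A perfect subnormal subgroup `K` that centralizes `M ⊓ K` modulo `R` centralizes `M`
modulo `R`. -/
theorem commutator_le_of_isSubnormal {G : Type} [Group G] {K M R : Subgroup G} [M.Normal]
    [R.Normal] (hperf : K ≤ ⁅K, K⁆) (hK : K.IsSubnormal) (hR : ⁅M ⊓ K, K⁆ ≤ R) :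
    ⁅M, K⁆ ≤ R := by
  suffices h : ∀ T : Subgroup G, T.IsSubnormal → K ≤ T → ⁅M ⊓ T, K⁆ ≤ R → ⁅M, K⁆ ≤ R from
    h K hK le_rfl hR
  intro T hT
  induction hT with
  | top => intro _ h; simpa using h
  | step T S hTS _ hN ih =>
    intro hKT hTR
    refine ih (hKT.trans hTS) ?_
    have h₁ : ⁅M ⊓ S, K⁆ ≤ M ⊓ T := by
      rw [Subgroup.commutator_le]
      intro x hx k hk
      refine ⟨?_, ?_⟩
      · exact Subgroup.commutator_le_left M ⊤
          (Subgroup.commutator_mem_commutator hx.1 (Subgroup.mem_top k))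
      · have := (Subgroup.normal_subgroupOf_iff hTS).1 hN k x (hKT hk) hx.2
        exact T.mul_mem this (T.inv_mem (hKT hk))
    have h₂ : ⁅⁅M ⊓ S, K⁆, K⁆ ≤ R := (Subgroup.commutator_mono h₁ le_rfl).trans hTR
    have h₃ : ⁅⁅K, K⁆, M ⊓ S⁆ ≤ R := commutator_commutator_le_of_rotate
      (by rwa [Subgroup.commutator_comm K]) h₂
    rw [Subgroup.commutator_comm]
    exact (Subgroup.commutator_mono hperf le_rfl).trans h₃

namespace ClosedProperty

variable {P : (X : Type) → [inst : Group X] → Prop}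

theorem of_surjective (hP : ClosedProperty P) {X Y : Type} [Group X] [Group Y] [Finite X]
    (f : X →* Y) (hf : Function.Surjective f) (h : P X) : P Y :=
  hP.iso _ _ ⟨QuotientGroup.quotientKerEquivOfSurjective f hf⟩ (hP.quot X h f.ker)

theorem of_injective (hP : ClosedProperty P) {X Y : Type} [Group X] [Group Y] [Finite Y]
    (f : X →* Y) (hf : Function.Injective f) (h : P Y) : P X :=
  hP.iso _ _ ⟨(MonoidHom.ofInjective hf).symm⟩ (hP.sub Y h f.range)

theorem of_ker (hP : ClosedProperty P) {X Y : Type} [Group X] [Group Y] [Finite X]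
    (f : X →* Y) (hk : P f.ker) (hr : P f.range) : P X := by
  have : Finite f.range := Finite.of_surjective _ f.rangeRestrict_surjective
  exact hP.ext X f.ker hk (hP.iso _ _ ⟨(QuotientGroup.quotientKerEquivRange f).symm⟩ hr)

theorem map (hP : ClosedProperty P) {X Y : Type} [Group X] [Group Y] [Finite X]
    (f : X →* Y) {A : Subgroup X} (h : P A) : P (A.map f) :=
  hP.of_surjective (f.subgroupMap A) (f.subgroupMap_surjective A) h

theorem mono (hP : ClosedProperty P) {X : Type} [Group X] [Finite X] {A B : Subgroup X}
    (hAB : A ≤ B) (h : P B) : P A :=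
  hP.of_injective (Subgroup.inclusion hAB) (Subgroup.inclusion_injective hAB) h

theorem of_map_subtype (hP : ClosedProperty P) {X : Type} [Group X] [Finite X]
    {K : Subgroup X} {A : Subgroup K} (h : P (A.map K.subtype)) : P A :=
  hP.iso _ _ ⟨(A.equivMapOfInjective K.subtype K.subtype_injective).symm⟩ h

theorem comap (hP : ClosedProperty P) {X Y : Type} [Group X] [Group Y] [Finite X] [Finite Y]
    (f : X →* Y) {A : Subgroup Y} (hk : P f.ker) (hA : P A) : P (A.comap f) := by
  refine hP.of_ker (f.comp (A.comap f).subtype) ?_ (hP.mono ?_ hA)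
  · refine hP.of_map_subtype (hP.mono ?_ hk)
    rintro _ ⟨x, hx, rfl⟩
    exact hx
  · rintro _ ⟨x, rfl⟩
    exact x.2

theorem of_commutator (hP : ClosedProperty P) {X : Type} [Group X] [Finite X]
    (h : P (commutator X)) : P X :=
  hP.ext X (commutator X) h 
    (hP.solv (Abelianization X) (Group.isSolvable_of_comm mul_comm))

theorem le_Op {G : Type} [Group G] {N : Subgroup G} (hN : N.Normal) (h : P N) :
    N ≤ Op P G := fun _ hx =>
  Subgroup.subset_closure (Set.mem_biUnion (show N ∈ {N : Subgroup G | N.Normal ∧ P ↥N} from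
    ⟨hN, h⟩) hx)

theorem sup (hP : ClosedProperty P) {G : Type} [Group G] [Finite G] {N M : Subgroup G}
    [N.Normal] (hN : P N) (hM : P M) : P ↥(N ⊔ M) := by
  refine hP.mono ?_ (hP.comap (QuotientGroup.mk' N) (A := M.map (QuotientGroup.mk' N))
    (by rwa [QuotientGroup.ker_mk']) (hP.map _ hM))
  rw [Subgroup.comap_map_eq, QuotientGroup.ker_mk', sup_comm]

theorem Op_mem (hP : ClosedProperty P) (G : Type) [Group G] [Finite G] : P (Op P G) := by
  obtain ⟨N, ⟨hN, hPN⟩, hmax⟩ := (Set.toFinite {N : Subgroup G | N.Normal ∧ P ↥N}).exists_maximal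
    ⟨⊥, Subgroup.normal_bot, hP.solv _ (Group.isSolvable_of_comm fun _ _ => Subsingleton.elim _ _)⟩
  have h : Op P G ≤ N := by
    refine (Subgroup.closure_le _).2 (Set.iUnion₂_subset fun M hM => ?_)
    have := hM.1
    have hle := hmax (y := N ⊔ M) ⟨inferInstance, hP.sup hPN hM.2⟩ le_sup_left
    exact fun x hx => hle ((le_sup_right : M ≤ N ⊔ M) hx)
  exact hP.mono h hPN

theorem Op_characteristic (hP : ClosedProperty P) (G : Type) [Group G] [Finite G] :
    (Op P G).Characteristic :=
  Subgroup.characteristic_iff_map_le.2 fun φ =>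
    le_Op ((Op_normal P G).map φ.toMonoidHom φ.surjective) (hP.map _ (hP.Op_mem G))

theorem map_Op_le (hP : ClosedProperty P) {G : Type} [Group G] [Finite G] (N : Subgroup G)
    [N.Normal] : (Op P N).map N.subtype ≤ Op P G := by
  have := hP.Op_characteristic N
  exact le_Op inferInstance (hP.map _ (hP.Op_mem N))

theorem le_Op_of_isSubnormal (hP : ClosedProperty P) {G : Type} [Group G] [Finite G]
    {K : Subgroup G} (hK : K.IsSubnormal) (h : P K) : K ≤ Op P G := by
  induction hn : Nat.card G using Nat.strong_induction_on generalizing G with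
  | _ n ih =>
    obtain rfl | ⟨N, hN, hKN, hlt⟩ := hK.lt_normal
    · exact le_Op inferInstance h
    · have hcard : Nat.card N < n := by
        rw [← hn]
        exact lt_of_le_of_ne (Subgroup.card_le_card_group N) fun he =>
          hlt.ne (Subgroup.eq_top_of_card_eq N he)
      have h' := ih _ hcard (hK.subgroupOf (K := N))
        (hP.of_map_subtype (by rwa [Subgroup.map_subgroupOf_eq_of_le hKN])) rfl
      rw [← Subgroup.map_subgroupOf_eq_of_le hKN]
      exact (Subgroup.map_mono h').trans (hP.map_Op_le N)

end ClosedProperty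

/-- A group that is not a `P`-group although all its proper normal subgroups are. -/
def IsMinimalNon (P : (X : Type) → [inst : Group X] → Prop) (X : Type) [Group X] : Prop :=
  ¬ P X ∧ ∀ N : Subgroup X, N.Normal → N = ⊤ ∨ P N

namespace ClosedProperty

variable {P : (X : Type) → [inst : Group X] → Prop}

theorem ker_center_quotient (hP : ClosedProperty P) (X : Type) [Group X] [Finite X] :
    P ((QuotientGroup.mk' (Subgroup.center (X ⧸ Op P X))).comp
      (QuotientGroup.mk' (Op P X))).ker := by
  rw [← MonoidHom.comap_ker, QuotientGroup.ker_mk']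
  refine hP.comap _ ?_ (hP.solv _ (Group.isSolvable_of_comm fun x y =>
    Subtype.ext (Subgroup.mem_center_iff.1 y.2 x)))
  rw [QuotientGroup.ker_mk']
  exact hP.Op_mem X

theorem isMinimalNon_of_isQuasisimple (hP : ClosedProperty P) {X : Type} [Group X] [Finite X]
    (hq : IsQuasisimple (X ⧸ Op P X)) (ho : Oup P X = ⊤) : IsMinimalNon P X := by
  obtain ⟨-, hs, a, b, hab⟩ := hq
  set f := (QuotientGroup.mk' (Subgroup.center (X ⧸ Op P X))).comp (QuotientGroup.mk' (Op P X))
    with hf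
  have hsurj : Function.Surjective f :=
    (QuotientGroup.mk'_surjective _).comp (QuotientGroup.mk'_surjective _)
  have hker : P f.ker := hP.ker_center_quotient X
  have hOp : Op P X ≤ f.ker := fun x hx => by
    have : QuotientGroup.mk' (Op P X) x = 1 := (QuotientGroup.eq_one_iff x).2 hx
    rw [MonoidHom.mem_ker, hf, MonoidHom.comp_apply, this, map_one]
  refine ⟨fun h => hab ?_, fun N hN => ?_⟩
  · obtain ⟨x, rfl⟩ := hsurj a
    have hx : x ∈ Op P X := le_Op (N := ⊤) inferInstance
      (hP.iso _ _ ⟨Subgroup.topEquiv.symm⟩ h) (Subgroup.mem_top x)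
    rw [MonoidHom.mem_ker.1 (hOp hx), one_mul, mul_one]
  · obtain h | h := (hN.map f hsurj).eq_bot_or_eq_top
    · exact .inr (hP.mono ((Subgroup.map_eq_bot_iff N).1 h) hker)
    · left
      have hsup : N ⊔ f.ker = ⊤ := by
        rw [← Subgroup.comap_map_eq, h, Subgroup.comap_top]
      have hquot : P (X ⧸ N) := by
        refine hP.of_surjective ((QuotientGroup.mk' N).comp f.ker.subtype) ?_ hker
        intro y
        obtain ⟨x, rfl⟩ := QuotientGroup.mk'_surjective N y
        obtain ⟨n, hn, k, hk, rfl⟩ := Subgroup.mem_sup_of_normal_left.1 (hsup ▸ Subgroup.mem_top x)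
        have : QuotientGroup.mk' N n = 1 := (QuotientGroup.eq_one_iff n).2 hn
        exact ⟨⟨k, hk⟩, by rw [map_mul, this, one_mul]; rfl⟩
      rw [eq_top_iff, ← ho]
      exact iInf₂_le N ⟨hN, hquot⟩

theorem commutator_eq_top (hP : ClosedProperty P) {X : Type} [Group X] [Finite X]
    (h : IsMinimalNon P X) : commutator X = ⊤ :=
  (h.2 _ inferInstance).resolve_right fun h' => h.1 (hP.of_commutator h')

theorem isQuasisimple_of_isMinimalNon (hP : ClosedProperty P) {X : Type} [Group X] [Finite X]
    (h : IsMinimalNon P X) : IsQuasisimple (X ⧸ Op P X) := by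
  set f := (QuotientGroup.mk' (Subgroup.center (X ⧸ Op P X))).comp (QuotientGroup.mk' (Op P X))
    with hf
  have hsurj : Function.Surjective f :=
    (QuotientGroup.mk'_surjective _).comp (QuotientGroup.mk'_surjective _)
  have hker : P f.ker := hP.ker_center_quotient X
  have hnc : ∃ a b : (X ⧸ Op P X) ⧸ Subgroup.center (X ⧸ Op P X), a * b ≠ b * a := by
    by_contra! hcomm
    exact h.1 (hP.of_ker f hker (hP.sub _ (hP.solv _ (Group.isSolvable_of_comm hcomm)) _))
  refine ⟨?_, ?_, hnc⟩
  · rw [commutator_def, ← Subgroup.map_top_of_surjective _ (QuotientGroup.mk'_surjective (Op P X)),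
      ← Subgroup.map_commutator, ← commutator_def, hP.commutator_eq_top h]
  · obtain ⟨a, b, hab⟩ := hnc
    refine { exists_pair_ne := ⟨_, _, hab⟩, eq_bot_or_eq_top_of_normal := fun N hN => ?_ }
    rw [← Subgroup.map_comap_eq_self_of_surjective hsurj N]
    obtain h' | h' := h.2 _ (hN.comap f)
    · exact .inr (by rw [h', Subgroup.map_top_of_surjective f hsurj])
    · left
      rw [Subgroup.map_eq_bot_iff, hf, ← MonoidHom.comap_ker]
      intro x hx
      have : QuotientGroup.mk' (Op P X) x = 1 :=
        (QuotientGroup.eq_one_iff x).2 (le_Op (hN.comap f) h' hx)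
      rw [Subgroup.mem_comap, this]
      exact one_mem _

theorem Oup_eq_top_of_isMinimalNon (hP : ClosedProperty P) {X : Type} [Group X] [Finite X]
    (h : IsMinimalNon P X) : Oup P X = ⊤ := by
  refine eq_top_iff.2 (le_iInf₂ fun N ⟨hN, hq⟩ => ?_)
  exact ((h.2 N hN).resolve_right fun hPN => h.1 (hP.ext X N hPN hq)).ge

theorem isPComponent_iff (hP : ClosedProperty P) {G : Type} [Group G] [Finite G]
    {K : Subgroup G} : IsPComponent P K ↔ K.IsSubnormal ∧ IsMinimalNon P K := by
  rw [IsPComponent, isSubnormal_iff]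
  exact and_congr_right fun _ => ⟨fun h => hP.isMinimalNon_of_isQuasisimple h.1 h.2,
    fun h => ⟨hP.isQuasisimple_of_isMinimalNon h, hP.Oup_eq_top_of_isMinimalNon h⟩⟩

theorem isMinimalNon_congr (hP : ClosedProperty P) {X Y : Type} [Group X] [Group Y] [Finite X]
    (e : X ≃* Y) (h : IsMinimalNon P X) : IsMinimalNon P Y := by
  have : Finite Y := Finite.of_equiv X e.toEquiv
  refine ⟨fun hY => h.1 (hP.iso _ _ ⟨e.symm⟩ hY), fun N hN => ?_⟩
  rw [← Subgroup.map_comap_eq_self_of_surjective (f := e.toMonoidHom) e.surjective N]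
  refine (h.2 _ (hN.comap e.toMonoidHom)).imp (fun h' => ?_) (hP.map _)
  rw [h', Subgroup.map_top_of_surjective _ e.surjective]

theorem le_OPE {G : Type} [Group G] {K : Subgroup G} (hK : IsPComponent P K) : K ≤ OPE P G :=
  (le_sSup (show K ∈ {K : Subgroup G | IsPComponent P K} from hK)).trans le_sup_right

theorem OPE_normal (hP : ClosedProperty P) (G : Type) [Group G] [Finite G] :
    (OPE P G).Normal := by
  have : (sSup {K : Subgroup G | IsPComponent P K}).Normal := by
    constructor
    intro x hx g
    have hmap : (sSup {K : Subgroup G | IsPComponent P K}).map (MulAut.conj g).toMonoidHom ≤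
        sSup {K : Subgroup G | IsPComponent P K} := by
      rw [Subgroup.map_le_iff_le_comap]
      refine sSup_le fun K hK => ?_
      rw [← Subgroup.map_le_iff_le_comap]
      refine le_sSup ?_
      obtain ⟨h₁, h₂⟩ := hP.isPComponent_iff.1 hK
      exact hP.isPComponent_iff.2 ⟨h₁.map (MulAut.conj g).surjective,
        hP.isMinimalNon_congr (K.equivMapOfInjective _ (MulAut.conj g).injective) h₂⟩
    exact hmap ⟨x, hx, rfl⟩
  exact Subgroup.sup_normal _ _

/-- `O_𝒫(G)` contains the centralizer of `O_{𝒫,E}(G)` modulo `O_𝒫(G)`. -/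
theorem le_Op_of_commutator_le (hP : ClosedProperty P) {G : Type} [Group G] [Finite G]
    {A : Subgroup G} (hA : ⁅A, OPE P G⁆ ≤ Op P G) : A ≤ Op P G := by
  have := hP.OPE_normal G
  let π := QuotientGroup.mk' (Op P G)
  have hM : ((OPE P G).map π).Normal :=
    Subgroup.Normal.map this π (QuotientGroup.mk'_surjective _)
  let C := (Subgroup.centralizer (((OPE P G).map π : Subgroup _) : Set (G ⧸ Op P G))).comap π
  have hC : ∀ B : Subgroup G, B ≤ C ↔ ⁅B, OPE P G⁆ ≤ Op P G := fun B => by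
    rw [← Subgroup.map_le_iff_le_comap, ← Subgroup.commutator_eq_bot_iff_le_centralizer,
      ← Subgroup.map_commutator, Subgroup.map_eq_bot_iff, QuotientGroup.ker_mk']
  have hCn : C.Normal := Subgroup.Normal.comap inferInstance π
  by_contra hcon
  have hCP : ¬ P C := fun h => hcon (((hC A).2 hA).trans (le_Op hCn h))
  obtain ⟨K, ⟨hKs, hKC, hKP⟩, hmin⟩ :=
    (Set.toFinite {K : Subgroup G | K.IsSubnormal ∧ K ≤ C ∧ ¬ P K}).exists_minimal
      ⟨C, hCn.isSubnormal, le_rfl, hCP⟩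
  have hKcomp : IsPComponent P K := by
    refine hP.isPComponent_iff.2 ⟨hKs, hKP, fun N hN => ?_⟩
    by_contra! hcon
    have hle : N.map K.subtype ≤ K := Subgroup.map_subtype_le N
    have h := hmin (y := N.map K.subtype) ⟨hN.isSubnormal.trans' hKs, hle.trans hKC,
      fun h => hcon.2 (hP.of_map_subtype h)⟩ hle
    refine hcon.1 (eq_top_iff.2 fun x _ => ?_)
    obtain ⟨y, hy, hyx⟩ := h x.2
    rwa [← Subtype.ext hyx]
  have hKM : K ≤ OPE P G := le_OPE hKcomp
  refine hKP (hP.of_commutator (hP.of_map_subtype (hP.mono ?_ (hP.Op_mem G))))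
  rw [Subgroup.map_subtype_commutator]
  exact (Subgroup.commutator_mono le_rfl hKM).trans ((hC K).1 hKC)

theorem map_Op_eq (hP : ClosedProperty P) {G : Type} [Group G] [Finite G] {H : Subgroup G}
    (hH : OPE P G ≤ H) : (Op P H).map H.subtype = Op P G := by
  have hM := hP.OPE_normal G
  have hOH : Op P G ≤ H := le_sup_left.trans hH
  refine le_antisymm (hP.le_Op_of_commutator_le ?_) ?_
  · have hn : (Op P H ⊓ (OPE P G).subgroupOf H).Normal := inferInstance
    rw [← Subgroup.map_subgroupOf_eq_of_le hH, ← Subgroup.map_commutator]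
    refine (Subgroup.map_mono (Subgroup.commutator_le_inf _ _)).trans ?_
    refine hP.le_Op_of_isSubnormal ?_ (hP.map _ (hP.mono inf_le_left (hP.Op_mem H)))
    refine Subgroup.IsSubnormal.trans (K := OPE P G) ?_ (Subgroup.Normal.isSubnormal ?_)
      hM.isSubnormal
    · rintro _ ⟨x, hx, rfl⟩
      exact hx.2
    · constructor
      rintro x ⟨y, hy, hyx⟩ g
      exact ⟨_, hn.conj_mem y hy ⟨g, hH g.2⟩, by simpa using hyx⟩
  · rw [← Subgroup.map_subgroupOf_eq_of_le hOH]
    refine Subgroup.map_mono (le_Op inferInstance (hP.of_map_subtype ?_))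
    rw [Subgroup.map_subgroupOf_eq_of_le hOH]
    exact hP.Op_mem G

theorem map_OPE_eq (hP : ClosedProperty P) {G : Type} [Group G] [Finite G] {H : Subgroup G}
    (hH : OPE P G ≤ H) : (OPE P H).map H.subtype = OPE P G := by
  have hM := hP.OPE_normal G
  have hOp := hP.map_Op_eq hH
  refine le_antisymm ?_ ?_
  · rw [Subgroup.map_le_iff_le_comap]
    refine sup_le ?_ (sSup_le fun K hK => ?_)
    · rw [← Subgroup.map_le_iff_le_comap, hOp]
      exact le_sup_left
    · obtain ⟨hKs, hKm⟩ := hP.isPComponent_iff.1 hK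
      obtain h | h := hKm.2 (((OPE P G).subgroupOf H).subgroupOf K) inferInstance
      · exact Subgroup.subgroupOf_eq_top.1 h
      · have hperf : K ≤ ⁅K, K⁆ := by
          rw [← Subgroup.map_subtype_commutator, hP.commutator_eq_top hKm,
            ← MonoidHom.range_eq_map, Subgroup.range_subtype]
        have hn : ((OPE P G).subgroupOf H).Normal := inferInstance
        have hinf : (OPE P G).subgroupOf H ⊓ K ≤ Op P H := by
          refine hP.le_Op_of_isSubnormal (hn.isSubnormal.inf hKs) ?_
          rw [← Subgroup.subgroupOf_map_subtype]
          exact hP.map _ h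
        have hc := commutator_le_of_isSubnormal (M := (OPE P G).subgroupOf H) (R := Op P H)
          hperf hKs ((Subgroup.commutator_mono hinf le_rfl).trans
            ((Subgroup.commutator_mono le_rfl le_top).trans (Subgroup.commutator_le_left _ ⊤)))
        have hc' := Subgroup.map_mono (f := H.subtype) hc
        rw [Subgroup.map_commutator, Subgroup.map_subgroupOf_eq_of_le hH, hOp,
          Subgroup.commutator_comm] at hc'
        rw [← Subgroup.map_le_iff_le_comap]
        exact (hP.le_Op_of_commutator_le hc').trans le_sup_left
  · refine sup_le ?_ (sSup_le fun K hK => ?_)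
    · rw [← hOp]
      exact Subgroup.map_mono le_sup_left
    · have hKH : K ≤ H := (le_OPE hK).trans hH
      obtain ⟨hKs, hKm⟩ := hP.isPComponent_iff.1 hK
      have : IsPComponent P (K.subgroupOf H) := hP.isPComponent_iff.2 ⟨hKs.subgroupOf,
        hP.isMinimalNon_congr (Subgroup.subgroupOfEquivOfLe hKH).symm hKm⟩
      rw [← Subgroup.map_subgroupOf_eq_of_le hKH]
      exact Subgroup.map_mono (le_OPE this)

end ClosedProperty

theorem statement_15
    (P : (X : Type) → [inst : Group X] → Prop)
    (hIso : ∀ (X Y : Type) [Group X] [Group Y] [Finite X], Nonempty (X ≃* Y) → P X → P Y)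
    (hSubClosed : ∀ (X : Type) [Group X] [Finite X], P X → ∀ H : Subgroup X, P ↥H)
    (hQuotClosed : ∀ (X : Type) [Group X] [Finite X], P X → ∀ (N : Subgroup X) [N.Normal], P (X ⧸ N))
    (hExtClosed : ∀ (X : Type) [Group X] [Finite X] (N : Subgroup X) [N.Normal],
      P ↥N → P (X ⧸ N) → P X)
    (hSolvP : ∀ (X : Type) [Group X] [Finite X], IsSolvable X → P X)
    (G : Type) [Group G] [Finite G] (H : Subgroup G)
    (hH : OPE P G ≤ H) :
    (OPE P ↥H).map H.subtype = OPE P G :=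
  ClosedProperty.map_OPE_eq ⟨hIso, hSubClosed, hQuotClosed, hExtClosed, hSolvP⟩ hH

end PaperPF
end
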